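/- arXiv:2203.00529 — 9 statements merged into one kernel-verified Lean document; each statement's English description precedes it below -/
import Mathlib

section
/- Let m, n be natural numbers. Suppose B, B' are m×n complex matrices and C, C' are n×m complex matrices satisfying B·C = 0, C·B = 0, B'·C' = 0 and C'·B' = 0. Then there exist invertible matrices g ∈ GL(m,ℂ) and h ∈ GL(n,ℂ) with B' = g·B·h⁻¹ and C' = h·C·g⁻¹ if and only if rank B = rank B' and rank C = rank C'. (This is the classification of G₀-orbits on the self-commuting cone X of gl(m|n): orbits are enumerated by the pairs (p,q) = (rank x⁺, rank x⁻).) -/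
open Matrix

section LinearAlgebra

variable {K V W V' W' U U' : Type*} [Field K]
  [AddCommGroup V] [Module K V] [AddCommGroup W] [Module K W]
  [AddCommGroup V'] [Module K V'] [AddCommGroup W'] [Module K W']
  [AddCommGroup U] [Module K U] [AddCommGroup U'] [Module K U']

/-- A linear map with a section splits its domain as the product of its codomain and its kernel. -/
def LinearMap.splitEquiv (F : V →ₗ[K] U) (S : U →ₗ[K] V) (hFS : ∀ u, F (S u) = u) :
    V ≃ₗ[K] U × LinearMap.ker F :=
  LinearEquiv.ofLinearMap
    (F.prod ((LinearMap.id - S ∘ₗ F).codRestrict (LinearMap.ker F) fun v => by simp [hFS]))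
    (S.coprod (LinearMap.ker F).subtype)
    (by
      apply LinearMap.ext
      rintro ⟨u, k, hk⟩
      have hk' : F k = 0 := hk
      ext <;> simp [hFS, hk'])
    (by ext v; simp)

lemma LinearMap.splitEquiv_section (F : V →ₗ[K] U) (S : U →ₗ[K] V) (hFS : ∀ u, F (S u) = u)
    (u : U) : F.splitEquiv S hFS (S u) = (u, 0) := by
  refine Prod.ext (hFS u) (Subtype.ext ?_)
  change S u - S (F (S u)) = 0
  rw [hFS, sub_self]

/-- Two split surjections from spaces of the same finite dimension, with isomorphic targets,
are related by an isomorphism compatible with both the surjections and their sections. -/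
lemma LinearMap.exists_equiv_of_split [FiniteDimensional K V] [FiniteDimensional K V']
    (hV : Module.finrank K V = Module.finrank K V')
    (F : V →ₗ[K] U) (S : U →ₗ[K] V) (hFS : ∀ u, F (S u) = u)
    (F' : V' →ₗ[K] U') (S' : U' →ₗ[K] V') (hFS' : ∀ u, F' (S' u) = u) (e : U ≃ₗ[K] U') :
    ∃ g : V ≃ₗ[K] V', (∀ v, F' (g v) = e (F v)) ∧ ∀ u, g (S u) = S' (e u) := by
  have hr : Module.finrank K (LinearMap.range F) = Module.finrank K U := by
    rw [LinearMap.range_eq_top.2 fun u => ⟨S u, hFS u⟩, finrank_top]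
  have hr' : Module.finrank K (LinearMap.range F') = Module.finrank K U' := by
    rw [LinearMap.range_eq_top.2 fun u => ⟨S' u, hFS' u⟩, finrank_top]
  have hk : Module.finrank K (LinearMap.ker F) = Module.finrank K (LinearMap.ker F') := by
    have h₁ := F.finrank_range_add_finrank_ker
    have h₂ := F'.finrank_range_add_finrank_ker
    have h₃ := e.finrank_eq
    omega
  let k := LinearEquiv.ofFinrankEq (LinearMap.ker F) (LinearMap.ker F') hk
  let φ := F.splitEquiv S hFS
  let φ' := F'.splitEquiv S' hFS'
  refine ⟨φ ≪≫ₗ (e.prodCongr k) ≪≫ₗ φ'.symm, fun v => ?_, fun u => ?_⟩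
  · exact congrArg Prod.fst (φ'.apply_symm_apply (e.prodCongr k (φ v)))
  · rw [LinearEquiv.trans_apply, LinearEquiv.trans_apply, LinearEquiv.symm_apply_eq,
      LinearMap.splitEquiv_section, LinearMap.splitEquiv_section]
    simp

/-- If `c ∘ b = 0`, then `range b × range c` is a direct summand of the middle space, in a way
compatible with the inclusion of `range b` and the projection to `range c`. -/
lemma LinearMap.exists_split_of_comp_eq_zero (b : W →ₗ[K] V) (c : V →ₗ[K] W')
    (hcb : c ∘ₗ b = 0) :
    ∃ (F : V →ₗ[K] LinearMap.range b × LinearMap.range c)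
      (S : LinearMap.range b × LinearMap.range c →ₗ[K] V),
      (∀ u, F (S u) = u) ∧ (∀ u, S (u, 0) = u) ∧ ∀ v, (F v).2 = c.rangeRestrict v := by
  obtain ⟨t, ht⟩ := c.rangeRestrict.exists_rightInverse_of_surjective c.range_rangeRestrict
  obtain ⟨π, hπ⟩ := (LinearMap.range b).subtype.exists_leftInverse_of_injective
    (LinearMap.range b).ker_subtype
  have ht' (w) : c.rangeRestrict (t w) = w := LinearMap.congr_fun ht w
  have hπ' (u : LinearMap.range b) : π u = u := LinearMap.congr_fun hπ u
  have hc (u : LinearMap.range b) : c.rangeRestrict u = 0 := by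
    obtain ⟨_, w, rfl⟩ := u
    exact Subtype.ext (LinearMap.congr_fun hcb w)
  refine ⟨(π - π ∘ₗ t ∘ₗ c.rangeRestrict).prod c.rangeRestrict,
    (LinearMap.range b).subtype.coprod t, ?_, by simp, fun _ => rfl⟩
  rintro ⟨u, w⟩
  have hcs : c.rangeRestrict (u + t w) = w := by rw [map_add, hc, ht', zero_add]
  refine Prod.ext ?_ hcs
  change π (u + t w) - π (t (c.rangeRestrict (u + t w))) = u
  rw [hcs, map_add, hπ', add_sub_cancel_right]

/-- Two pairs of mutually annihilating maps `W ⇄ V` with the same ranks are conjugate. -/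
lemma LinearMap.exists_conj_of_finrank_range_eq [FiniteDimensional K V] [FiniteDimensional K W]
    (b b' : W →ₗ[K] V) (c c' : V →ₗ[K] W)
    (hbc : b ∘ₗ c = 0) (hcb : c ∘ₗ b = 0) (hbc' : b' ∘ₗ c' = 0) (hcb' : c' ∘ₗ b' = 0)
    (hb : Module.finrank K (LinearMap.range b) = Module.finrank K (LinearMap.range b'))
    (hc : Module.finrank K (LinearMap.range c) = Module.finrank K (LinearMap.range c')) :
    ∃ (g : V ≃ₗ[K] V) (h : W ≃ₗ[K] W),
      (∀ w, g (b w) = b' (h w)) ∧ ∀ v, h (c v) = c' (g v) := by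
  obtain ⟨F, S, hFS, hS, hF⟩ := LinearMap.exists_split_of_comp_eq_zero b c hcb
  obtain ⟨F', S', hFS', hS', hF'⟩ := LinearMap.exists_split_of_comp_eq_zero b' c' hcb'
  obtain ⟨G, T, hGT, hT, hG⟩ := LinearMap.exists_split_of_comp_eq_zero c b hbc
  obtain ⟨G', T', hGT', hT', hG'⟩ := LinearMap.exists_split_of_comp_eq_zero c' b' hbc'
  let e₁ := LinearEquiv.ofFinrankEq _ _ hb
  let e₂ := LinearEquiv.ofFinrankEq _ _ hc
  obtain ⟨g, hg, hg'⟩ :=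
    LinearMap.exists_equiv_of_split rfl F S hFS F' S' hFS' (e₁.prodCongr e₂)
  obtain ⟨h, hh, hh'⟩ :=
    LinearMap.exists_equiv_of_split rfl G T hGT G' T' hGT' (e₂.prodCongr e₁)
  refine ⟨g, h, fun w => ?_, fun v => ?_⟩
  · calc g (b w) = g (S (b.rangeRestrict w, 0)) := by rw [hS]; rfl
      _ = e₁ (b.rangeRestrict w) := by rw [hg', ← hS']; simp
      _ = (G' (h w)).2 := by rw [hh, ← hG]; rfl
      _ = b' (h w) := by rw [hG']; rfl
  · calc h (c v) = h (T (c.rangeRestrict v, 0)) := by rw [hT]; rfl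
      _ = e₂ (c.rangeRestrict v) := by rw [hh', ← hT']; simp
      _ = (F' (g v)).2 := by rw [hg, ← hF]; rfl
      _ = c' (g v) := by rw [hF']; rfl

end LinearAlgebra

/-- Every linear automorphism of `Fin k → K` is given by an invertible matrix. -/
lemma Matrix.GeneralLinearGroup.exists_toLin'_eq {K : Type*} [Field K] {k : ℕ}
    (e : (Fin k → K) ≃ₗ[K] (Fin k → K)) :
    ∃ g : GL (Fin k) K, Matrix.toLin' (g : Matrix (Fin k) (Fin k) K) = e.toLinearMap :=
  ⟨⟨LinearMap.toMatrix' e.toLinearMap, LinearMap.toMatrix' e.symm.toLinearMap,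
    by rw [← LinearMap.toMatrix'_comp]; simp, by rw [← LinearMap.toMatrix'_comp]; simp⟩,
    Matrix.toLin'_toMatrix' _⟩

/-- Multiplying by invertible matrices on both sides preserves the rank. -/
lemma Matrix.rank_units_mul_mul_units {K : Type*} [Field K] {k l : ℕ}
    (g : GL (Fin k) K) (h : GL (Fin l) K) (A : Matrix (Fin k) (Fin l) K) :
    ((g : Matrix (Fin k) (Fin k) K) * A * (h : Matrix (Fin l) (Fin l) K)).rank = A.rank := by
  rw [Matrix.rank_mul_eq_left_of_isUnit_det _ _ ((Matrix.isUnit_iff_isUnit_det _).1 h.isUnit),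
    Matrix.rank_mul_eq_right_of_isUnit_det _ _ ((Matrix.isUnit_iff_isUnit_det _).1 g.isUnit)]

/-- Classification of `G₀`-orbits on the self-commuting cone `X` of `gl(m|n)`:
two self-commuting odd elements `x = [[0,B],[C,0]]` and `x' = [[0,B'],[C',0]]` are
conjugate under `GL(m,ℂ) × GL(n,ℂ)` iff `rank B = rank B'` and `rank C = rank C'`. -/
theorem gl_orbits_on_selfcommuting_cone (m n : ℕ)
    (B B' : Matrix (Fin m) (Fin n) ℂ) (C C' : Matrix (Fin n) (Fin m) ℂ)
    (hBC : B * C = 0) (hCB : C * B = 0)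
    (hBC' : B' * C' = 0) (hCB' : C' * B' = 0) :
    (∃ (g : GL (Fin m) ℂ) (h : GL (Fin n) ℂ),
        B' = (g : Matrix (Fin m) (Fin m) ℂ) * B * ((h⁻¹ : GL (Fin n) ℂ) : Matrix (Fin n) (Fin n) ℂ) ∧
        C' = (h : Matrix (Fin n) (Fin n) ℂ) * C * ((g⁻¹ : GL (Fin m) ℂ) : Matrix (Fin m) (Fin m) ℂ)) ↔
      (B.rank = B'.rank ∧ C.rank = C'.rank) := by
  constructor
  · rintro ⟨g, h, rfl, rfl⟩
    exact ⟨(Matrix.rank_units_mul_mul_units g h⁻¹ B).symm,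
      (Matrix.rank_units_mul_mul_units h g⁻¹ C).symm⟩
  · rintro ⟨hB, hC⟩
    obtain ⟨g, h, hg, hh⟩ := LinearMap.exists_conj_of_finrank_range_eq
      (Matrix.toLin' B) (Matrix.toLin' B') (Matrix.toLin' C) (Matrix.toLin' C')
      (by rw [← Matrix.toLin'_mul, hBC, map_zero]) (by rw [← Matrix.toLin'_mul, hCB, map_zero])
      (by rw [← Matrix.toLin'_mul, hBC', map_zero]) (by rw [← Matrix.toLin'_mul, hCB', map_zero])
      hB hC
    obtain ⟨g', hg'⟩ := Matrix.GeneralLinearGroup.exists_toLin'_eq g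
    obtain ⟨h', hh'⟩ := Matrix.GeneralLinearGroup.exists_toLin'_eq h
    have hgB : (g' : Matrix (Fin m) (Fin m) ℂ) * B = B' * (h' : Matrix (Fin n) (Fin n) ℂ) := by
      apply Matrix.toLin'.injective
      rw [Matrix.toLin'_mul, Matrix.toLin'_mul, hg', hh']
      exact LinearMap.ext hg
    have hhC : (h' : Matrix (Fin n) (Fin n) ℂ) * C = C' * (g' : Matrix (Fin m) (Fin m) ℂ) := by
      apply Matrix.toLin'.injective
      rw [Matrix.toLin'_mul, Matrix.toLin'_mul, hg', hh']
      exact LinearMap.ext hh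
    refine ⟨g', h', ?_, ?_⟩
    · rw [hgB, Matrix.mul_assoc, Units.mul_inv, Matrix.mul_one]
    · rw [hhC, Matrix.mul_assoc, Units.mul_inv, Matrix.mul_one]
end

section
/- Let n be a natural number. Suppose B, B' are symmetric n×n complex matrices and C, C' are skew-symmetric n×n complex matrices satisfying B·C = 0 and B'·C' = 0 (equivalently, by the symmetry assumptions, C·B = 0 and C'·B' = 0). Then there exists g ∈ GL(n,ℂ) with B' = g·B·gᵀ and C' = (gᵀ)⁻¹·C·g⁻¹ if and only if rank B = rank B' and rank C = rank C'. Moreover, for any such pair (B,C) the rank of C is even, say 2s, and rank B + rank C ≤ n; so the orbits are indexed by pairs (r,s) of nonnegative integers with r + 2s ≤ n, where r = rank B and 2s = rank C. (Classification of G₀-orbits on the self-commuting cone X of p(n).) -/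
open Matrix

theorem mul_mul_transpose_cancel {K ι κ : Type*} [Field K] [Fintype ι] [Fintype κ]
    [DecidableEq ι] {g : Matrix κ ι K} {h : Matrix ι κ K} (hg : h * g = 1) (M : Matrix ι ι K) :
    h * (g * M * gᵀ) * hᵀ = M := by
  have hg' : gᵀ * hᵀ = 1 := by rw [← transpose_mul, hg, transpose_one]
  rw [← Matrix.mul_assoc, ← Matrix.mul_assoc, hg, Matrix.one_mul, Matrix.mul_assoc, hg',
    Matrix.mul_one]

theorem rank_fromBlocks_diag {K α β : Type*} [Field K] [Fintype α] [Fintype β]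
    (A : Matrix α α K) (D : Matrix β β K) :
    (fromBlocks A 0 0 D).rank = A.rank + D.rank := by
  let e := LinearEquiv.sumArrowLequivProdArrow α β K K
  have h : (fromBlocks A 0 0 D).mulVecLin
      = e.symm.toLinearMap ∘ₗ (A.mulVecLin.prodMap D.mulVecLin) ∘ₗ e.toLinearMap := by
    apply LinearMap.ext
    intro v
    ext i
    rcases i with i | i <;>
      simp [e, Function.comp_def, LinearEquiv.sumArrowLequivProdArrow,
        Equiv.sumArrowEquivProdArrow, mulVec, dotProduct]
  rw [rank, h, LinearMap.range_comp, LinearEquiv.finrank_map_eq,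
    LinearMap.range_comp_of_range_eq_top _ (LinearEquiv.range e), LinearMap.range_prodMap, rank,
    rank]
  let f : (A.mulVecLin.range × D.mulVecLin.range) →ₗ[K] (α → K) × (β → K) :=
    A.mulVecLin.range.subtype.prodMap D.mulVecLin.range.subtype
  have hf : Function.Injective f :=
    Function.Injective.prodMap Subtype.val_injective Subtype.val_injective
  have := LinearMap.finrank_range_of_inj hf
  rwa [LinearMap.range_prodMap, Submodule.range_subtype, Submodule.range_subtype,
    Module.finrank_prod] at this

section Congruence

variable {K : Type*} [Field K]
  {ι κ μ α β γ : Type*} [Fintype ι] [Fintype κ] [Fintype μ] [Fintype α] [Fintype β] [Fintype γ]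
  [DecidableEq ι] [DecidableEq κ] [DecidableEq μ] [DecidableEq α] [DecidableEq β] [DecidableEq γ]

/-- Congruence of square matrices, possibly over different index types. -/
def MatrixCongruent (M : Matrix ι ι K) (N : Matrix κ κ K) : Prop :=
  ∃ (g : Matrix κ ι K) (h : Matrix ι κ K), g * h = 1 ∧ h * g = 1 ∧ N = g * M * gᵀ

/-- The equivalence of pairs `(B, C) ∼ (g B gᵀ, (g⁻¹)ᵀ C g⁻¹)`, possibly over different index
types. -/
def PairEquiv (B C : Matrix ι ι K) (B' C' : Matrix κ κ K) : Prop :=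
  ∃ (g : Matrix κ ι K) (h : Matrix ι κ K),
    g * h = 1 ∧ h * g = 1 ∧ B' = g * B * gᵀ ∧ C' = hᵀ * C * h

theorem MatrixCongruent.trans {M : Matrix ι ι K} {N : Matrix κ κ K} {P : Matrix μ μ K}
    (h₁ : MatrixCongruent M N) (h₂ : MatrixCongruent N P) : MatrixCongruent M P := by
  obtain ⟨g, h, gh, hg, rfl⟩ := h₁
  obtain ⟨g', h', gh', hg', rfl⟩ := h₂
  refine ⟨g' * g, h * h', ?_, ?_, ?_⟩
  · rw [Matrix.mul_assoc, ← Matrix.mul_assoc g, gh, Matrix.one_mul, gh']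
  · rw [Matrix.mul_assoc, ← Matrix.mul_assoc h', hg', Matrix.one_mul, hg]
  · simp only [transpose_mul, Matrix.mul_assoc]

theorem PairEquiv.trans {B C : Matrix ι ι K} {B' C' : Matrix κ κ K} {B'' C'' : Matrix μ μ K}
    (h₁ : PairEquiv B C B' C') (h₂ : PairEquiv B' C' B'' C'') : PairEquiv B C B'' C'' := by
  obtain ⟨g, h, gh, hg, rfl, rfl⟩ := h₁
  obtain ⟨g', h', gh', hg', rfl, rfl⟩ := h₂
  refine ⟨g' * g, h * h', ?_, ?_, ?_, ?_⟩
  · rw [Matrix.mul_assoc, ← Matrix.mul_assoc g, gh, Matrix.one_mul, gh']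
  · rw [Matrix.mul_assoc, ← Matrix.mul_assoc h', hg', Matrix.one_mul, hg]
  · simp only [transpose_mul, Matrix.mul_assoc]
  · simp only [transpose_mul, Matrix.mul_assoc]

theorem PairEquiv.symm {B C : Matrix ι ι K} {B' C' : Matrix κ κ K}
    (h₁ : PairEquiv B C B' C') : PairEquiv B' C' B C := by
  obtain ⟨g, h, gh, hg, rfl, rfl⟩ := h₁
  refine ⟨h, g, hg, gh, (mul_mul_transpose_cancel hg B).symm, ?_⟩
  have := mul_mul_transpose_cancel (g := hᵀ) (h := gᵀ)
    (by rw [← transpose_mul, hg, transpose_one]) C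
  simpa only [transpose_transpose] using this.symm

theorem MatrixCongruent.rank_eq {M : Matrix ι ι K} {N : Matrix κ κ K} (h₁ : MatrixCongruent M N) :
    N.rank = M.rank := by
  obtain ⟨g, h, gh, hg, rfl⟩ := h₁
  apply le_antisymm
  · exact (rank_mul_le_left _ _).trans (rank_mul_le_right _ _)
  · conv_lhs => rw [← mul_mul_transpose_cancel hg M]
    exact (rank_mul_le_left _ _).trans (rank_mul_le_right _ _)

theorem PairEquiv.matrixCongruent_left {B C : Matrix ι ι K} {B' C' : Matrix κ κ K}
    (h₁ : PairEquiv B C B' C') : MatrixCongruent B B' := by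
  obtain ⟨g, h, gh, hg, hB, -⟩ := h₁
  exact ⟨g, h, gh, hg, hB⟩

theorem PairEquiv.matrixCongruent_right {B C : Matrix ι ι K} {B' C' : Matrix κ κ K}
    (h₁ : PairEquiv B C B' C') : MatrixCongruent C C' := by
  obtain ⟨g, h, gh, hg, -, hC⟩ := h₁
  refine ⟨hᵀ, gᵀ, ?_, ?_, by simpa only [transpose_transpose] using hC⟩
  · rw [← transpose_mul, gh, transpose_one]
  · rw [← transpose_mul, hg, transpose_one]

theorem MatrixCongruent.exists_pairEquiv_left {B : Matrix ι ι K} {B' : Matrix κ κ K}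
    (h₁ : MatrixCongruent B B') (C : Matrix ι ι K) : ∃ C', PairEquiv B C B' C' := by
  obtain ⟨g, h, gh, hg, hB⟩ := h₁
  exact ⟨_, g, h, gh, hg, hB, rfl⟩

theorem MatrixCongruent.exists_pairEquiv_right {C : Matrix ι ι K} {C' : Matrix κ κ K}
    (h₁ : MatrixCongruent C C') (B : Matrix ι ι K) : ∃ B', PairEquiv B C B' C' := by
  obtain ⟨g, h, gh, hg, hC⟩ := h₁
  refine ⟨_, hᵀ, gᵀ, ?_, ?_, rfl, by simpa only [transpose_transpose] using hC⟩
  · rw [← transpose_mul, gh, transpose_one]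
  · rw [← transpose_mul, hg, transpose_one]

theorem MatrixCongruent.transpose_eq_smul {M : Matrix ι ι K} {N : Matrix κ κ K}
    (h₁ : MatrixCongruent M N) {ε : K} (hM : Mᵀ = ε • M) : Nᵀ = ε • N := by
  obtain ⟨g, h, gh, hg, rfl⟩ := h₁
  simp only [transpose_mul, transpose_transpose, hM, Matrix.mul_assoc, Matrix.mul_smul,
    Matrix.smul_mul]

theorem PairEquiv.mul_eq_zero {B C : Matrix ι ι K} {B' C' : Matrix κ κ K}
    (h₁ : PairEquiv B C B' C') (h₀ : B * C = 0) : B' * C' = 0 := by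
  obtain ⟨g, h, gh, hg, rfl, rfl⟩ := h₁
  have hg' : gᵀ * hᵀ = 1 := by rw [← transpose_mul, hg, transpose_one]
  calc g * B * gᵀ * (hᵀ * C * h) = g * (B * ((gᵀ * hᵀ) * C)) * h := by
        simp only [Matrix.mul_assoc]
    _ = 0 := by rw [hg', Matrix.one_mul, h₀, Matrix.mul_zero, Matrix.zero_mul]

theorem PairEquiv.fromBlocks {B C : Matrix ι ι K} {B' C' : Matrix κ κ K}
    (h₁ : PairEquiv B C B' C') (A D : Matrix α α K) :
    PairEquiv (fromBlocks A 0 0 B) (fromBlocks D 0 0 C) (fromBlocks A 0 0 B')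
      (fromBlocks D 0 0 C') := by
  obtain ⟨g, h, gh, hg, rfl, rfl⟩ := h₁
  refine ⟨Matrix.fromBlocks 1 0 0 g, Matrix.fromBlocks 1 0 0 h, ?_, ?_, ?_, ?_⟩ <;>
    simp [fromBlocks_multiply, fromBlocks_transpose, gh, hg]

theorem MatrixCongruent.fromBlocks_left {A : Matrix α α K} {A' : Matrix γ γ K}
    (h₁ : MatrixCongruent A A') (S : Matrix β β K) :
    MatrixCongruent (fromBlocks A 0 0 S) (fromBlocks A' 0 0 S) := by
  obtain ⟨g, h, gh, hg, rfl⟩ := h₁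
  refine ⟨fromBlocks g 0 0 1, fromBlocks h 0 0 1, ?_, ?_, ?_⟩ <;>
    simp [fromBlocks_multiply, fromBlocks_transpose, gh, hg]

theorem matrixCongruent_submatrix (M : Matrix ι ι K) (e : κ ≃ ι) :
    MatrixCongruent M (M.submatrix e e) := by
  refine ⟨(1 : Matrix ι ι K).submatrix e id, (1 : Matrix ι ι K).submatrix id e, ?_, ?_, ?_⟩
  · rw [← submatrix_mul _ _ _ id _ Function.bijective_id]; simp
  · rw [← submatrix_mul _ _ _ e _ e.bijective]; simp
  · rw [transpose_submatrix, transpose_one]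
    conv_rhs => rw [← submatrix_id_id M]
    rw [← submatrix_mul _ _ _ id _ Function.bijective_id,
      ← submatrix_mul _ _ _ id _ Function.bijective_id]; simp

/-- Splitting off an invertible diagonal block of a symmetric or skew-symmetric matrix. -/
theorem matrixCongruent_fromBlocks_of_isUnit_det {M : Matrix (α ⊕ β) (α ⊕ β) K} {ε : K}
    (hM : Mᵀ = ε • M) (hA : IsUnit M.toBlocks₁₁.det) :
    ∃ S : Matrix β β K, MatrixCongruent M (fromBlocks M.toBlocks₁₁ 0 0 S) := by
  obtain ⟨A, X, Y, D, rfl⟩ : ∃ A X Y D, M = fromBlocks A X Y D :=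
    ⟨_, _, _, _, (fromBlocks_toBlocks M).symm⟩
  rw [toBlocks_fromBlocks₁₁] at hA ⊢
  rw [fromBlocks_transpose, fromBlocks_smul, fromBlocks_inj] at hM
  obtain ⟨hAt, hYt, hXt, -⟩ := hM
  have hAA : A * A⁻¹ = 1 := mul_nonsing_inv A hA
  have hAA' : A⁻¹ * A = 1 := nonsing_inv_mul A hA
  have key : X + A * (-(Y * A⁻¹))ᵀ = 0 := by
    have h2 : Aᵀ * (A⁻¹)ᵀ = 1 := by rw [← transpose_mul, hAA', transpose_one]
    have h3 : ε • (A * (A⁻¹)ᵀ) = 1 := by rw [← Matrix.smul_mul, ← hAt, h2]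
    rw [transpose_neg, transpose_mul, hYt, Matrix.mul_neg, Matrix.mul_smul, Matrix.mul_smul,
      ← Matrix.mul_assoc, ← Matrix.smul_mul, h3, Matrix.one_mul, add_neg_cancel]
  refine ⟨-(Y * A⁻¹) * X + D, fromBlocks 1 0 (-(Y * A⁻¹)) 1, fromBlocks 1 0 (Y * A⁻¹) 1,
    ?_, ?_, ?_⟩
  · simp [fromBlocks_multiply]
  · simp [fromBlocks_multiply]
  · have hY : -(Y * A⁻¹) * A + Y = 0 := by
      rw [Matrix.neg_mul, Matrix.mul_assoc, hAA', Matrix.mul_one, neg_add_cancel]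
    rw [fromBlocks_transpose, fromBlocks_multiply, fromBlocks_multiply]
    simp only [Matrix.one_mul, Matrix.zero_mul, Matrix.mul_one, Matrix.mul_zero, add_zero,
      transpose_one, transpose_zero, hY, zero_add]
    rw [fromBlocks_inj]
    refine ⟨rfl, ?_, rfl, ?_⟩
    · rw [add_comm, key]
    · simp

end Congruence

section Splitting

variable {K : Type*} [Field K]

/-- An injection of `Fin a` into `Fin n` extends to a splitting of `Fin n`. -/
theorem exists_sum_equiv_of_injective {a n : ℕ} {f : Fin a → Fin n} (hf : Function.Injective f) :
    ∃ m, n = a + m ∧ ∃ e : Fin a ⊕ Fin m ≃ Fin n, ∀ i, e (Sum.inl i) = f i := by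
  classical
  obtain ⟨m, rfl⟩ := Nat.exists_eq_add_of_le
    (by simpa using Fintype.card_le_of_injective f hf : a ≤ n)
  have hc : Fintype.card (Fin m) = Fintype.card ((Set.range f)ᶜ : Set (Fin (a + m))) := by
    rw [Fintype.card_compl_set, Set.card_range_of_injective hf]; simp
  refine ⟨m, rfl, (Equiv.sumCongr (Equiv.ofInjective f hf) (Fintype.equivOfCardEq hc)).trans
    (Equiv.Set.sumCompl (Set.range f)), fun i => ?_⟩
  simp

/-- Splitting off an invertible principal submatrix. -/
theorem exists_matrixCongruent_fromBlocks {a n : ℕ} {M : Matrix (Fin n) (Fin n) K} {ε : K}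
    (hM : Mᵀ = ε • M) {f : Fin a → Fin n} (hf : Function.Injective f)
    (hA : IsUnit (M.submatrix f f).det) :
    ∃ m, n = a + m ∧ ∃ S : Matrix (Fin m) (Fin m) K,
      MatrixCongruent M (fromBlocks (M.submatrix f f) 0 0 S) := by
  obtain ⟨m, hm, e, he⟩ := exists_sum_equiv_of_injective hf
  have hc := matrixCongruent_submatrix M e
  have hb : (M.submatrix e e).toBlocks₁₁ = M.submatrix f f := by
    ext i j; simp [toBlocks₁₁, he]
  obtain ⟨S, hS⟩ := matrixCongruent_fromBlocks_of_isUnit_det (hc.transpose_eq_smul hM)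
    (by rwa [hb])
  exact ⟨m, hm, S, by simpa only [hb] using hc.trans hS⟩

theorem exists_matrixCongruent_diag_ne_zero [NeZero (2 : K)] {n : ℕ}
    {M : Matrix (Fin n) (Fin n) K} (hM : M.IsSymm) (h0 : M ≠ 0) :
    ∃ N : Matrix (Fin n) (Fin n) K, MatrixCongruent M N ∧ ∃ i, N i i ≠ 0 := by
  by_cases hd : ∃ i, M i i ≠ 0
  · exact ⟨M, ⟨1, 1, by simp, by simp, by simp⟩, hd⟩
  push Not at hd
  obtain ⟨i, j, hij⟩ : ∃ i j, M i j ≠ 0 := by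
    by_contra! h
    exact h0 (Matrix.ext h)
  have hne : i ≠ j := by rintro rfl; exact hij (hd i)
  refine ⟨_, ⟨transvection i j 1, transvection i j (-1), ?_, ?_, rfl⟩, i, ?_⟩
  · rw [transvection_mul_transvection_same _ _ hne]; simp
  · rw [transvection_mul_transvection_same _ _ hne]; simp
  · have hji : M j i = M i j := hM.apply i j
    have : (transvection i j (1 : K) * M * (transvection i j (1 : K))ᵀ) i i = 2 * M i j := by
      rw [transvection, transpose_add, transpose_one, transpose_single]
      simp only [add_mul, mul_add, Matrix.one_mul, Matrix.mul_one, Matrix.add_apply,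
        single_mul_apply_same, mul_single_apply_same, hd, hji]
      ring
    rw [this]
    exact mul_ne_zero two_ne_zero hij

/-- A nonzero symmetric matrix over an algebraically closed field splits off the form `(1)`. -/
theorem exists_matrixCongruent_one_of_isSymm [IsAlgClosed K] [NeZero (2 : K)] {n : ℕ}
    {M : Matrix (Fin n) (Fin n) K} (hM : M.IsSymm) (h0 : M ≠ 0) :
    ∃ m, n = 1 + m ∧ ∃ S : Matrix (Fin m) (Fin m) K,
      MatrixCongruent M (fromBlocks (1 : Matrix (Fin 1) (Fin 1) K) 0 0 S) := by
  obtain ⟨N, hN, i, hi⟩ := exists_matrixCongruent_diag_ne_zero hM h0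
  have hNt : Nᵀ = (1 : K) • N := hN.transpose_eq_smul (by rw [one_smul]; exact hM)
  obtain ⟨m, hm, S, hS⟩ := exists_matrixCongruent_fromBlocks hNt (f := fun _ : Fin 1 => i)
    (Function.injective_of_subsingleton _) (by simpa using hi)
  refine ⟨m, hm, S, (hN.trans hS).trans (MatrixCongruent.fromBlocks_left ?_ S)⟩
  obtain ⟨z, hz⟩ := IsAlgClosed.exists_eq_mul_self (N i i)
  have hz0 : z ≠ 0 := by rintro rfl; exact hi (by simpa using hz)
  have hsub : N.submatrix (fun _ : Fin 1 => i) (fun _ => i) = !![z * z] := by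
    ext a b; fin_cases a; fin_cases b; simp [hz]
  rw [hsub]
  refine ⟨!![z⁻¹], !![z], ?_, ?_, ?_⟩ <;> ext a b <;> fin_cases a <;> fin_cases b <;>
    simp [hz0, Matrix.mul_apply]

/-- A nonzero skew-symmetric matrix splits off the standard symplectic plane. -/
theorem exists_matrixCongruent_symplectic_of_skew [NeZero (2 : K)] {n : ℕ}
    {M : Matrix (Fin n) (Fin n) K} (hM : Mᵀ = -M) (h0 : M ≠ 0) :
    ∃ m, n = 2 + m ∧ ∃ S : Matrix (Fin m) (Fin m) K,
      MatrixCongruent M (fromBlocks !![0, 1; -1, 0] 0 0 S) := by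
  have hsk : ∀ i j, M j i = -M i j := fun i j => congrFun (congrFun hM i) j
  have hd : ∀ i, M i i = 0 := fun i => by
    have h2 : 2 * M i i = 0 := by linear_combination hsk i i
    exact (mul_eq_zero.mp h2).resolve_left two_ne_zero
  obtain ⟨i, j, hij⟩ : ∃ i j, M i j ≠ 0 := by
    by_contra! h
    exact h0 (Matrix.ext h)
  have hne : i ≠ j := by rintro rfl; exact hij (hd i)
  have hsub : M.submatrix ![i, j] ![i, j] = !![0, M i j; -M i j, 0] := by
    ext a b; fin_cases a <;> fin_cases b <;> simp [hd, hsk i j]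
  obtain ⟨m, hm, S, hS⟩ := exists_matrixCongruent_fromBlocks (f := ![i, j])
    (show Mᵀ = (-1 : K) • M by rw [neg_one_smul, hM])
    (by intro a b; fin_cases a <;> fin_cases b <;> simp [hne, hne.symm])
    (by rw [hsub, det_fin_two_of]; simpa using hij)
  refine ⟨m, hm, S, hS.trans (MatrixCongruent.fromBlocks_left ?_ S)⟩
  rw [hsub]
  refine ⟨!![(M i j)⁻¹, 0; 0, 1], !![M i j, 0; 0, 1], ?_, ?_, ?_⟩ <;> ext a b <;>
    fin_cases a <;> fin_cases b <;> simp [hij, Matrix.mul_apply, Fin.sum_univ_two]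

theorem even_rank_of_skew [NeZero (2 : K)] (n : ℕ) (C : Matrix (Fin n) (Fin n) K)
    (hC : Cᵀ = -C) : Even C.rank := by
  induction n using Nat.strong_induction_on with
  | _ n ih =>
    by_cases h0 : C = 0
    · rw [h0, rank_zero]; exact Even.zero
    obtain ⟨m, hm, S, hS⟩ := exists_matrixCongruent_symplectic_of_skew hC h0
    have ht := hS.transpose_eq_smul (ε := -1) (by rw [neg_one_smul, hC])
    rw [fromBlocks_transpose, fromBlocks_smul, fromBlocks_inj] at ht
    rw [← hS.rank_eq, rank_fromBlocks_diag, rank_of_det_ne_zero (by simp [det_fin_two_of])]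
    have := ih m (by omega) S (by simpa using ht.2.2.2)
    simpa [Nat.even_add] using this

/-- The pairs of a symmetric and a skew-symmetric matrix with product zero. -/
structure IsSelfCommuting {ι : Type*} [Fintype ι] (B C : Matrix ι ι K) : Prop where
  isSymm : B.IsSymm
  skew : Cᵀ = -C
  mul_eq_zero : B * C = 0

theorem IsSelfCommuting.of_pairEquiv {ι κ : Type*} [Fintype ι] [Fintype κ] [DecidableEq ι]
    [DecidableEq κ] {B C : Matrix ι ι K} {B' C' : Matrix κ κ K} (h : IsSelfCommuting B C)
    (e : PairEquiv B C B' C') : IsSelfCommuting B' C' where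
  isSymm := by
    have := e.matrixCongruent_left.transpose_eq_smul (ε := 1) (by rw [one_smul]; exact h.isSymm)
    rwa [one_smul] at this
  skew := by
    have := e.matrixCongruent_right.transpose_eq_smul (ε := -1) (by rw [neg_one_smul, h.skew])
    rwa [neg_one_smul] at this
  mul_eq_zero := e.mul_eq_zero h.mul_eq_zero

theorem IsSelfCommuting.exists_pairEquiv_one [IsAlgClosed K] [NeZero (2 : K)] {n : ℕ}
    {B C : Matrix (Fin n) (Fin n) K} (h : IsSelfCommuting B C) (h0 : B ≠ 0) :
    ∃ m, n = 1 + m ∧ ∃ B₁ C₁ : Matrix (Fin m) (Fin m) K, IsSelfCommuting B₁ C₁ ∧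
      PairEquiv B C (fromBlocks (1 : Matrix (Fin 1) (Fin 1) K) 0 0 B₁)
        (fromBlocks (0 : Matrix (Fin 1) (Fin 1) K) 0 0 C₁) := by
  obtain ⟨m, hm, B₁, hB⟩ := exists_matrixCongruent_one_of_isSymm h.isSymm h0
  obtain ⟨C', hC'⟩ := hB.exists_pairEquiv_left C
  have hs := h.of_pairEquiv hC'
  obtain ⟨X, Y, Z, C₁, rfl⟩ : ∃ X Y Z W, C' = fromBlocks X Y Z W :=
    ⟨_, _, _, _, (fromBlocks_toBlocks C').symm⟩
  obtain ⟨h₁, h₂, h₃⟩ := hs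
  rw [IsSymm, fromBlocks_transpose, fromBlocks_inj] at h₁
  rw [fromBlocks_transpose, fromBlocks_neg, fromBlocks_inj] at h₂
  rw [fromBlocks_multiply, ← fromBlocks_zero, fromBlocks_inj] at h₃
  simp only [Matrix.one_mul, Matrix.zero_mul, add_zero, zero_add] at h₃
  obtain ⟨rfl, rfl, -, h₃⟩ := h₃
  have hZ : Z = 0 := by simpa using h₂.2.2.1.symm
  subst hZ
  exact ⟨m, hm, B₁, C₁, ⟨h₁.2.2.2, h₂.2.2.2, h₃⟩, hC'⟩

theorem IsSelfCommuting.exists_pairEquiv_symplectic [NeZero (2 : K)] {n : ℕ}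
    {C : Matrix (Fin n) (Fin n) K} (h : IsSelfCommuting 0 C) (h0 : C ≠ 0) :
    ∃ m, n = 2 + m ∧ ∃ C₁ : Matrix (Fin m) (Fin m) K, IsSelfCommuting 0 C₁ ∧
      PairEquiv 0 C (fromBlocks (0 : Matrix (Fin 2) (Fin 2) K) 0 0 0)
        (fromBlocks (!![0, 1; -1, 0] : Matrix (Fin 2) (Fin 2) K) 0 0 C₁) := by
  obtain ⟨m, hm, C₁, hC⟩ := exists_matrixCongruent_symplectic_of_skew h.skew h0
  obtain ⟨B', hB'⟩ := hC.exists_pairEquiv_right 0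
  have hs := (h.of_pairEquiv hB').skew
  rw [fromBlocks_transpose, fromBlocks_neg, fromBlocks_inj] at hs
  obtain rfl : B' = 0 := by
    obtain ⟨g, -, -, -, hg⟩ := hB'.matrixCongruent_left
    simpa using hg
  exact ⟨m, hm, C₁, ⟨isSymm_zero, hs.2.2.2, Matrix.zero_mul _⟩, by rwa [fromBlocks_zero]⟩

theorem rank_eq_zero_iff_eq_zero {ι κ : Type*} [Fintype ι] [Fintype κ] {A : Matrix ι κ K} :
    A.rank = 0 ↔ A = 0 := by
  rw [rank, Submodule.finrank_eq_zero, LinearMap.range_eq_bot]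
  exact ⟨fun h => mulVec_injective (funext fun v => by simpa using LinearMap.congr_fun h v),
    fun h => by rw [h, mulVecLin_zero]⟩

theorem pairEquiv_of_rank_eq [IsAlgClosed K] [NeZero (2 : K)] {n : ℕ}
    {B B' C C' : Matrix (Fin n) (Fin n) K} (h : IsSelfCommuting B C) (h' : IsSelfCommuting B' C')
    (hB : B.rank = B'.rank) (hC : C.rank = C'.rank) : PairEquiv B C B' C' := by
  induction n using Nat.strong_induction_on with
  | _ n ih =>
    have hB0 : B = 0 ↔ B' = 0 := by
      rw [← rank_eq_zero_iff_eq_zero, hB, rank_eq_zero_iff_eq_zero]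
    have hC0 : C = 0 ↔ C' = 0 := by
      rw [← rank_eq_zero_iff_eq_zero, hC, rank_eq_zero_iff_eq_zero]
    by_cases hz : B = 0
    · obtain rfl := hB0.mp hz
      subst hz
      by_cases hz : C = 0
      · obtain rfl := hC0.mp hz
        subst hz
        exact ⟨1, 1, by simp, by simp, by simp, by simp⟩
      · obtain ⟨m, hm, C₁, h₁, e₁⟩ := h.exists_pairEquiv_symplectic hz
        obtain ⟨m', hm', C₂, h₂, e₂⟩ := h'.exists_pairEquiv_symplectic (mt hC0.mpr hz)
        obtain rfl : m = m' := by omega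
        rw [← e₁.matrixCongruent_right.rank_eq, ← e₂.matrixCongruent_right.rank_eq,
          rank_fromBlocks_diag, rank_fromBlocks_diag, add_right_inj] at hC
        exact (e₁.trans ((ih m (by omega) h₁ h₂ rfl hC).fromBlocks _ _)).trans e₂.symm
    · obtain ⟨m, hm, B₁, C₁, h₁, e₁⟩ := h.exists_pairEquiv_one hz
      obtain ⟨m', hm', B₂, C₂, h₂, e₂⟩ := h'.exists_pairEquiv_one (mt hB0.mpr hz)
      obtain rfl : m = m' := by omega
      rw [← e₁.matrixCongruent_right.rank_eq, ← e₂.matrixCongruent_right.rank_eq,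
        rank_fromBlocks_diag, rank_fromBlocks_diag, add_right_inj] at hC
      rw [← e₁.matrixCongruent_left.rank_eq, ← e₂.matrixCongruent_left.rank_eq,
        rank_fromBlocks_diag, rank_fromBlocks_diag, add_right_inj] at hB
      exact (e₁.trans ((ih m (by omega) h₁ h₂ hB hC).fromBlocks _ _)).trans e₂.symm

end Splitting

/-- Classification of `G₀ ≅ GL(n,ℂ)`-orbits on the self-commuting cone `X` of the periplectic
Lie superalgebra `p(n)`: for symmetric `B, B'` and skew-symmetric `C, C'` with `B·C = 0` and
`B'·C' = 0`, the pairs are in the same orbit (under `g·(B,C) = (g·B·gᵀ, (g⁻¹)ᵀ·C·g⁻¹)`) iff the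
ranks agree; moreover `rank C` is even and `rank B + rank C ≤ n`. -/
theorem p_orbits_on_selfcommuting_cone (n : ℕ) (B B' C C' : Matrix (Fin n) (Fin n) ℂ)
    (hBs : B.IsSymm) (hB's : B'.IsSymm)
    (hCk : Cᵀ = -C) (hC'k : C'ᵀ = -C')
    (hBC : B * C = 0) (hB'C' : B' * C' = 0) :
    ((∃ g : GL (Fin n) ℂ,
        B' = (g : Matrix (Fin n) (Fin n) ℂ) * B * (g : Matrix (Fin n) (Fin n) ℂ)ᵀ ∧
        C' = ((g⁻¹ : GL (Fin n) ℂ) : Matrix (Fin n) (Fin n) ℂ)ᵀ * C *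
              ((g⁻¹ : GL (Fin n) ℂ) : Matrix (Fin n) (Fin n) ℂ)) ↔
      (B.rank = B'.rank ∧ C.rank = C'.rank))
    ∧ Even C.rank ∧ B.rank + C.rank ≤ n := by
  refine ⟨⟨?_, ?_⟩, even_rank_of_skew n C hCk, ?_⟩
  · rintro ⟨g, hB, hC⟩
    have e : PairEquiv B C B' C' := ⟨g, (g⁻¹ : GL (Fin n) ℂ), g.mul_inv, g.inv_mul, hB, hC⟩
    exact ⟨e.matrixCongruent_left.rank_eq.symm, e.matrixCongruent_right.rank_eq.symm⟩
  · rintro ⟨hB, hC⟩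
    obtain ⟨g, h, gh, hg, hB', hC'⟩ :=
      pairEquiv_of_rank_eq ⟨hBs, hCk, hBC⟩ ⟨hB's, hC'k, hB'C'⟩ hB hC
    exact ⟨⟨g, h, gh, hg⟩, hB', hC'⟩
  · simpa using rank_add_rank_le_card_of_mul_eq_zero hBC
end

section
/- Let B be an m×n complex matrix and C an n×m complex matrix with B·C = 0 and C·B = 0, and set k := rank B + rank C (note k ≤ min(m,n)). Then the rank of the ℂ-linear map Φ : Mₘ(ℂ) × Mₙ(ℂ) → M_{m×n}(ℂ) × M_{n×m}(ℂ) given by Φ(u,v) = (u·B − B·v, v·C − C·u) equals m·n − (m−k)·(n−k). (This is the instance for gl(m|n) of the orbit-dimension formula dim Φ(A) = |Δ₁∖A^⊥|/2 + |A|: Φ(u,v) = [diag(u,v), x] computes the tangent space [g₀, x] of the G₀-orbit of x.) -/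
open Matrix

section HomDiff

variable {K V W : Type*} [Field K] [AddCommGroup V] [Module K V] [AddCommGroup W] [Module K W]

/-- The linear map `(u, v) ↦ u ∘ f - f ∘ v`, i.e. the infinitesimal action of
`End W × End V` on `f : V → W`. -/
def homDiff (f : V →ₗ[K] W) : ((W →ₗ[K] W) × (V →ₗ[K] V)) →ₗ[K] (V →ₗ[K] W) where
  toFun p := p.1 ∘ₗ f - f ∘ₗ p.2
  map_add' p q := by ext; simp; abel
  map_smul' a p := by ext; simp [smul_sub]

theorem homDiff_apply (f : V →ₗ[K] W) (u : W →ₗ[K] W) (v : V →ₗ[K] V) :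
    homDiff f (u, v) = u ∘ₗ f - f ∘ₗ v := rfl

/-- Every linear map over a field has a generalized inverse. -/
theorem exists_comp_comp_eq_self (f : V →ₗ[K] W) : ∃ g : W →ₗ[K] V, f ∘ₗ g ∘ₗ f = f := by
  obtain ⟨s, hs⟩ := f.rangeRestrict.exists_rightInverse_of_surjective f.range_rangeRestrict
  obtain ⟨p, hp⟩ := (LinearMap.range f).subtype.exists_leftInverse_of_injective
    (Submodule.ker_subtype _)
  refine ⟨s ∘ₗ p, ?_⟩
  ext x
  have h1 : p (f x) = f.rangeRestrict x := LinearMap.congr_fun hp (f.rangeRestrict x)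
  have h2 := congrArg Subtype.val (LinearMap.congr_fun hs (f.rangeRestrict x))
  simpa [h1] using h2

/-- Restriction of `X : V → W` to a map `ker f → W ⧸ range f`. -/
def toHomKerCoker (f : V →ₗ[K] W) :
    (V →ₗ[K] W) →ₗ[K] (LinearMap.ker f →ₗ[K] W ⧸ LinearMap.range f) where
  toFun X := (LinearMap.range f).mkQ ∘ₗ X ∘ₗ (LinearMap.ker f).subtype
  map_add' X Y := by ext; simp
  map_smul' a X := by ext; simp

theorem toHomKerCoker_surjective (f : V →ₗ[K] W) : Function.Surjective (toHomKerCoker f) := by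
  intro Y
  obtain ⟨s, hs⟩ := (LinearMap.range f).mkQ.exists_rightInverse_of_surjective
    (Submodule.range_mkQ _)
  obtain ⟨r, hr⟩ := (LinearMap.ker f).subtype.exists_leftInverse_of_injective
    (Submodule.ker_subtype _)
  refine ⟨s ∘ₗ Y ∘ₗ r, ?_⟩
  ext x
  have h1 := LinearMap.congr_fun hs (Y (r x))
  have h2 := LinearMap.congr_fun hr x
  simp only [LinearMap.comp_apply, LinearMap.id_apply, Submodule.subtype_apply] at h2
  simp only [toHomKerCoker, LinearMap.coe_mk, AddHom.coe_mk, LinearMap.comp_apply,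
    Submodule.subtype_apply, h2] at h1 ⊢
  exact h1

theorem range_homDiff (f : V →ₗ[K] W) :
    LinearMap.range (homDiff f) = LinearMap.ker (toHomKerCoker f) := by
  apply le_antisymm
  · rintro _ ⟨⟨u, v⟩, rfl⟩
    rw [LinearMap.mem_ker]
    ext x
    have hx : f x = 0 := x.2
    simp [toHomKerCoker, homDiff_apply, hx]
  · intro X hX
    obtain ⟨g, hg⟩ := exists_comp_comp_eq_self f
    have hg' (x : V) : f (g (f x)) = f x := LinearMap.congr_fun hg x
    have hX' (x : V) (hx : f x = 0) : ∃ y, f y = X x := by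
      have h := LinearMap.congr_fun (LinearMap.mem_ker.1 hX) (⟨x, hx⟩ : LinearMap.ker f)
      simpa [toHomKerCoker] using h
    refine ⟨(X ∘ₗ g, -(g ∘ₗ X ∘ₗ (LinearMap.id - g ∘ₗ f))), ?_⟩
    ext x
    obtain ⟨y, hy⟩ := hX' (x - g (f x)) (by simp [hg'])
    have h : f (g (X (x - g (f x)))) = X (x - g (f x)) := by rw [← hy, hg']
    simp only [homDiff_apply, LinearMap.sub_apply, LinearMap.comp_apply, LinearMap.neg_apply,
      LinearMap.id_apply, map_neg, h]
    simp

/-- The infinitesimal action of `End W × End V` on pairs `(f, g)` of maps `V ⇄ W`. -/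
def pairDiff (f : V →ₗ[K] W) (g : W →ₗ[K] V) :
    ((W →ₗ[K] W) × (V →ₗ[K] V)) →ₗ[K] ((V →ₗ[K] W) × (W →ₗ[K] V)) :=
  (homDiff f).prod (homDiff g ∘ₗ (LinearEquiv.prodComm K _ _).toLinearMap)

theorem pairDiff_apply (f : V →ₗ[K] W) (g : W →ₗ[K] V) (u : W →ₗ[K] W) (v : V →ₗ[K] V) :
    pairDiff f g (u, v) = (u ∘ₗ f - f ∘ₗ v, v ∘ₗ g - g ∘ₗ u) := rfl

/-- Extension of a map `W ⧸ range f → ker f` to a map `W → V`. -/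
def ofHomCokerKer (f : V →ₗ[K] W) :
    (W ⧸ LinearMap.range f →ₗ[K] LinearMap.ker f) →ₗ[K] (W →ₗ[K] V) where
  toFun Y := (LinearMap.ker f).subtype ∘ₗ Y ∘ₗ (LinearMap.range f).mkQ
  map_add' X Y := by ext; simp
  map_smul' a X := by ext; simp

theorem ofHomCokerKer_injective (f : V →ₗ[K] W) : Function.Injective (ofHomCokerKer f) := by
  intro X Y h
  ext x
  exact LinearMap.congr_fun h x

/-- A map `g` with `f ∘ g = 0` and `g ∘ f = 0` is induced by a map `W ⧸ range f → ker f`. -/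
theorem exists_ofHomCokerKer_eq (f : V →ₗ[K] W) (g : W →ₗ[K] V) (hfg : f ∘ₗ g = 0)
    (hgf : g ∘ₗ f = 0) : ∃ h, ofHomCokerKer f h = g := by
  refine ⟨(LinearMap.range f).liftQ (g.codRestrict (LinearMap.ker f) fun x => ?_) ?_, ?_⟩
  · exact LinearMap.congr_fun hfg x
  · rintro _ ⟨x, rfl⟩
    exact Subtype.ext (LinearMap.congr_fun hgf x)
  · ext x
    rfl

theorem range_ofHomCokerKer_apply (f : V →ₗ[K] W)
    (h : W ⧸ LinearMap.range f →ₗ[K] LinearMap.ker f) :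
    LinearMap.range (ofHomCokerKer f h) =
      (LinearMap.range h).map (LinearMap.ker f).subtype := by
  change LinearMap.range ((LinearMap.ker f).subtype ∘ₗ h ∘ₗ (LinearMap.range f).mkQ) = _
  rw [LinearMap.range_comp, LinearMap.range_comp_of_range_eq_top _ (Submodule.range_mkQ _)]

/-- The elements of the range of `pairDiff` with vanishing first component come from the range of
`homDiff` on the maps `W ⧸ range f → ker f`. -/
theorem map_ker_homDiff (f : V →ₗ[K] W) (h : W ⧸ LinearMap.range f →ₗ[K] LinearMap.ker f) :
    (LinearMap.ker (homDiff f)).map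
        (homDiff (ofHomCokerKer f h) ∘ₗ (LinearEquiv.prodComm K _ _).toLinearMap) =
      (LinearMap.range (homDiff h)).map (ofHomCokerKer f) := by
  apply le_antisymm
  · rintro _ ⟨⟨u, v⟩, huv, rfl⟩
    have huv' (x : V) : u (f x) = f (v x) :=
      sub_eq_zero.1 (LinearMap.congr_fun (LinearMap.mem_ker.1 huv) x)
    refine ⟨_, ⟨(v.restrict (p := LinearMap.ker f) (q := LinearMap.ker f) ?_,
      (LinearMap.range f).mapQ (LinearMap.range f) u ?_), rfl⟩, ?_⟩
    · intro x hx
      rw [LinearMap.mem_ker] at hx ⊢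
      rw [← huv', hx, map_zero]
    · rintro _ ⟨x, rfl⟩
      exact ⟨v x, (huv' x).symm⟩
    · ext x
      rfl
  · rintro _ ⟨_, ⟨⟨v, u⟩, rfl⟩, rfl⟩
    obtain ⟨s, hs⟩ := (LinearMap.range f).mkQ.exists_rightInverse_of_surjective
      (Submodule.range_mkQ _)
    obtain ⟨r, hr⟩ := (LinearMap.ker f).subtype.exists_leftInverse_of_injective
      (Submodule.ker_subtype _)
    refine ⟨(s ∘ₗ u ∘ₗ (LinearMap.range f).mkQ, (LinearMap.ker f).subtype ∘ₗ v ∘ₗ r), ?_, ?_⟩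
    · rw [SetLike.mem_coe, LinearMap.mem_ker]
      ext x
      have hx : (Submodule.Quotient.mk (f x) : W ⧸ LinearMap.range f) = 0 :=
        (Submodule.Quotient.mk_eq_zero _).2 ⟨x, rfl⟩
      simp [homDiff_apply, hx]
    · ext x
      have h1 (y) : r (y : LinearMap.ker f) = y := LinearMap.congr_fun hr y
      have h2 (y) : Submodule.Quotient.mk (s y) = y := LinearMap.congr_fun hs y
      simp [homDiff_apply, ofHomCokerKer, h1, h2]

/-- The range of a product map has dimension the rank of the first map plus the dimension of
the image under the second map of the kernel of the first one. -/
theorem finrank_range_prod {E : Type*} [AddCommGroup E] [Module K E] [FiniteDimensional K E]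
    (f : E →ₗ[K] V) (g : E →ₗ[K] W) :
    Module.finrank K (LinearMap.range (f.prod g)) =
      Module.finrank K (LinearMap.range f) +
        Module.finrank K ((LinearMap.ker f).map g) := by
  have h1 := (f.prod g).finrank_range_add_finrank_ker
  have h2 := f.finrank_range_add_finrank_ker
  have h3 := (g.domRestrict (LinearMap.ker f)).finrank_range_add_finrank_ker
  have h4 : LinearMap.ker (f.prod g) =
      (LinearMap.ker (g.domRestrict (LinearMap.ker f))).map (LinearMap.ker f).subtype := by
    ext x
    simp [and_comm]
  rw [h4, Submodule.finrank_map_subtype_eq] at h1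
  rw [LinearMap.range_domRestrict] at h3
  omega

variable [FiniteDimensional K V] [FiniteDimensional K W]

theorem finrank_range_homDiff (f : V →ₗ[K] W) :
    Module.finrank K (LinearMap.range (homDiff f)) +
      (Module.finrank K V - Module.finrank K (LinearMap.range f)) *
        (Module.finrank K W - Module.finrank K (LinearMap.range f)) =
      Module.finrank K V * Module.finrank K W := by
  have h1 := (toHomKerCoker f).finrank_range_add_finrank_ker
  have h2 := f.finrank_range_add_finrank_ker
  have h3 := (LinearMap.range f).finrank_quotient_add_finrank
  rw [LinearMap.range_eq_top.2 (toHomKerCoker_surjective f), finrank_top,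
    Module.finrank_linearMap, Module.finrank_linearMap] at h1
  rw [range_homDiff, ← h1, ← h2, ← h3]
  simp [add_comm]

theorem finrank_range_pairDiff (f : V →ₗ[K] W) (g : W →ₗ[K] V) (hfg : f ∘ₗ g = 0)
    (hgf : g ∘ₗ f = 0) :
    Module.finrank K (LinearMap.range (pairDiff f g)) =
      Module.finrank K W * Module.finrank K V -
        (Module.finrank K W -
          (Module.finrank K (LinearMap.range f) + Module.finrank K (LinearMap.range g))) *
        (Module.finrank K V -
          (Module.finrank K (LinearMap.range f) + Module.finrank K (LinearMap.range g))) := by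
  obtain ⟨h, rfl⟩ := exists_ofHomCokerKer_eq f g hfg hgf
  have h1 := finrank_range_homDiff f
  have h2 := finrank_range_homDiff h
  have h3 : Module.finrank K (LinearMap.ker f) =
      Module.finrank K V - Module.finrank K (LinearMap.range f) := by
    have := f.finrank_range_add_finrank_ker
    omega
  have h4 : Module.finrank K (W ⧸ LinearMap.range f) =
      Module.finrank K W - Module.finrank K (LinearMap.range f) :=
    (LinearMap.range f).finrank_quotient
  rw [pairDiff, finrank_range_prod, map_ker_homDiff, range_ofHomCokerKer_apply,
    Submodule.finrank_map_subtype_eq,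
    (Submodule.equivMapOfInjective _ (ofHomCokerKer_injective f) _).finrank_eq.symm]
  rw [h3, h4, Nat.sub_sub, Nat.sub_sub, mul_comm (_ - _) (_ - Module.finrank K (LinearMap.range f))]
    at h2
  rw [mul_comm (Module.finrank K W)]
  refine (Nat.sub_eq_of_eq_add ?_).symm
  rw [← h1, ← h2]
  ring

end HomDiff

/-- Orbit-dimension formula for `gl(m|n)`: for a self-commuting odd element
`x = [[0,B],[C,0]]` of rank `k = rank B + rank C`, the rank of the linear map
`Φ(u,v) = (u·B − B·v, v·C − C·u)` (computing the tangent space `[g₀, x]` of the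
`G₀`-orbit of `x`) equals `m·n − (m−k)·(n−k)`. -/
theorem gl_orbit_dimension (m n : ℕ)
    (B : Matrix (Fin m) (Fin n) ℂ) (C : Matrix (Fin n) (Fin m) ℂ)
    (hBC : B * C = 0) (hCB : C * B = 0)
    (Φ : (Matrix (Fin m) (Fin m) ℂ × Matrix (Fin n) (Fin n) ℂ) →ₗ[ℂ]
         (Matrix (Fin m) (Fin n) ℂ × Matrix (Fin n) (Fin m) ℂ))
    (hΦ : ∀ (u : Matrix (Fin m) (Fin m) ℂ) (v : Matrix (Fin n) (Fin n) ℂ),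
        Φ (u, v) = (u * B - B * v, v * C - C * u)) :
    Module.finrank ℂ (LinearMap.range Φ) =
      m * n - (m - (B.rank + C.rank)) * (n - (B.rank + C.rank)) := by
  have hcomp : ((toLin'.prodCongr toLin').toLinearMap ∘ₗ Φ) =
      pairDiff (toLin' B) (toLin' C) ∘ₗ (toLin'.prodCongr toLin').toLinearMap := by
    refine LinearMap.ext fun ⟨u, v⟩ => ?_
    simp [hΦ, pairDiff_apply, toLin'_mul]
  have hrange : Module.finrank ℂ (LinearMap.range Φ) =
      Module.finrank ℂ (LinearMap.range (pairDiff (toLin' B) (toLin' C))) := by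
    rw [← LinearEquiv.finrank_map_eq (toLin'.prodCongr toLin') (LinearMap.range Φ)]
    rw [← LinearEquiv.range_comp (toLin'.prodCongr toLin') (pairDiff (toLin' B) (toLin' C)),
      ← hcomp, LinearMap.range_comp]
  rw [hrange, finrank_range_pairDiff]
  · rw [Module.finrank_fin_fun, Module.finrank_fin_fun]
    rfl
  · rw [← toLin'_mul, hBC, map_zero]
  · rw [← toLin'_mul, hCB, map_zero]
end

section
/- Let B be an m×n complex matrix and C an n×m complex matrix with B·C = 0 and C·B = 0. Then the rank of the ℂ-linear map Φ : Mₘ(ℂ) × Mₙ(ℂ) → M_{m×n}(ℂ) × M_{n×m}(ℂ), Φ(u,v) = (u·B − B·v, v·C − C·u), equals the rank of the ℂ-linear map Ψ : M_{m×n}(ℂ) × M_{n×m}(ℂ) → Mₘ(ℂ) × Mₙ(ℂ), Ψ(P,Q) = (B·Q + P·C, C·P + Q·B). (This is the gl(m|n) instance of the lemma that sdim [g, x] = 0 for a self-commuting odd element x: Φ is the even-to-odd part and Ψ the odd-to-even part of the super-adjoint action ad x, and their images have equal dimension.) -/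
open Matrix

/-- Linear maps that are adjoint with respect to left-nondegenerate bilinear forms have ranges of
the same dimension. -/
theorem finrank_range_eq_of_adjoint {K V W : Type*} [Field K]
    [AddCommGroup V] [Module K V] [AddCommGroup W] [Module K W] [FiniteDimensional K W]
    (f : V →ₗ[K] Module.Dual K V) (g : W →ₗ[K] Module.Dual K W)
    (hf : Function.Injective f) (hg : Function.Injective g)
    (Φ : V →ₗ[K] W) (Ψ : W →ₗ[K] V) (h : ∀ v w, g w (Φ v) = f (Ψ w) v) :
    Module.finrank K (LinearMap.range Φ) = Module.finrank K (LinearMap.range Ψ) := by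
  have hcomp : f ∘ₗ Ψ = Φ.dualMap ∘ₗ g := by
    ext w v
    simp [h]
  have hg' : Function.Surjective g :=
    (LinearMap.injective_iff_surjective_of_finrank_eq_finrank
      Subspace.dual_finrank_eq.symm).mp hg
  rw [← LinearMap.finrank_range_dualMap_eq_finrank_range,
    ← LinearMap.range_comp_of_range_eq_top Φ.dualMap (LinearMap.range_eq_top.mpr hg'), ← hcomp,
    LinearMap.range_comp]
  exact (Submodule.equivMapOfInjective f hf _).finrank_eq.symm

/-- The supertrace form on the even part of `gl(m|n)`. -/
def evenSupertraceForm (K ι κ : Type*) [CommRing K] [Fintype ι] [Fintype κ] :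
    (Matrix ι ι K × Matrix κ κ K) →ₗ[K] Module.Dual K (Matrix ι ι K × Matrix κ κ K) :=
  LinearMap.mk₂ K (fun a b => (b.1 * a.1).trace - (b.2 * a.2).trace)
    (fun _ _ _ => by simp [mul_add]; ring) (fun _ _ _ => by simp [mul_sub])
    (fun _ _ _ => by simp [add_mul]; ring) (fun _ _ _ => by simp [mul_sub])

/-- The supertrace form on the odd part of `gl(m|n)`. -/
def oddSupertraceForm (K ι κ : Type*) [CommRing K] [Fintype ι] [Fintype κ] :
    (Matrix ι κ K × Matrix κ ι K) →ₗ[K] Module.Dual K (Matrix ι κ K × Matrix κ ι K) :=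
  LinearMap.mk₂ K (fun a b => (b.1 * a.2).trace - (b.2 * a.1).trace)
    (fun _ _ _ => by simp [Matrix.mul_add]; ring) (fun _ _ _ => by simp [mul_sub])
    (fun _ _ _ => by simp [Matrix.add_mul]; ring) (fun _ _ _ => by simp [mul_sub])

theorem evenSupertraceForm_injective (K ι κ : Type*) [CommRing K] [Fintype ι] [Fintype κ] :
    Function.Injective (evenSupertraceForm K ι κ) := by
  intro a b hab
  refine Prod.ext (Matrix.ext_iff_trace_mul_left.mpr fun x => ?_)
    (Matrix.ext_iff_trace_mul_left.mpr fun x => ?_)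
  · simpa [evenSupertraceForm] using LinearMap.congr_fun hab (x, 0)
  · simpa [evenSupertraceForm] using LinearMap.congr_fun hab (0, x)

theorem oddSupertraceForm_injective (K ι κ : Type*) [CommRing K] [Fintype ι] [Fintype κ] :
    Function.Injective (oddSupertraceForm K ι κ) := by
  intro a b hab
  refine Prod.ext (Matrix.ext_iff_trace_mul_left.mpr fun x => ?_)
    (Matrix.ext_iff_trace_mul_left.mpr fun x => ?_)
  · simpa [oddSupertraceForm] using LinearMap.congr_fun hab (0, x)
  · simpa [oddSupertraceForm] using LinearMap.congr_fun hab (x, 0)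

/-- The `gl(m|n)` instance of `sdim [g,x] = 0` for a self-commuting odd element `x`:
the even-to-odd part `Φ` and the odd-to-even part `Ψ` of `ad x` have equal rank. -/
theorem gl_sdim_bracket_zero (m n : ℕ)
    (B : Matrix (Fin m) (Fin n) ℂ) (C : Matrix (Fin n) (Fin m) ℂ)
    (hBC : B * C = 0) (hCB : C * B = 0)
    (Φ : (Matrix (Fin m) (Fin m) ℂ × Matrix (Fin n) (Fin n) ℂ) →ₗ[ℂ]
         (Matrix (Fin m) (Fin n) ℂ × Matrix (Fin n) (Fin m) ℂ))
    (hΦ : ∀ (u : Matrix (Fin m) (Fin m) ℂ) (v : Matrix (Fin n) (Fin n) ℂ),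
        Φ (u, v) = (u * B - B * v, v * C - C * u))
    (Ψ : (Matrix (Fin m) (Fin n) ℂ × Matrix (Fin n) (Fin m) ℂ) →ₗ[ℂ]
         (Matrix (Fin m) (Fin m) ℂ × Matrix (Fin n) (Fin n) ℂ))
    (hΨ : ∀ (P : Matrix (Fin m) (Fin n) ℂ) (Q : Matrix (Fin n) (Fin m) ℂ),
        Ψ (P, Q) = (B * Q + P * C, C * P + Q * B)) :
    Module.finrank ℂ (LinearMap.range Φ) = Module.finrank ℂ (LinearMap.range Ψ) := by
  refine finrank_range_eq_of_adjoint _ _ (evenSupertraceForm_injective ℂ (Fin m) (Fin n))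
    (oddSupertraceForm_injective ℂ (Fin m) (Fin n)) Φ Ψ ?_
  rintro ⟨u, v⟩ ⟨P, Q⟩
  rw [hΦ, hΨ]
  simp only [evenSupertraceForm, oddSupertraceForm, LinearMap.mk₂_apply, Matrix.sub_mul,
    Matrix.mul_add, trace_sub, trace_add, Matrix.mul_assoc]
  rw [trace_mul_comm B, trace_mul_comm C, Matrix.mul_assoc, Matrix.mul_assoc]
  ring
end

section
/- Let B be an m×n complex matrix and C an n×m complex matrix with B·C = 0 and C·B = 0, set x := [[0,B],[C,0]] and J := diag(Iₘ, −Iₙ) as (m+n)×(m+n) block matrices, and define the ℂ-linear operator D on M_{m+n}(ℂ) by D(z) := x·z − J·z·J·x. Then D ∘ D = 0, and the homology ker D ⧸ range D is a complex vector space of dimension (m + n − 2k)², where k := rank B + rank C. (This realizes, at the level of dimensions, the fact that g_x = ker(ad x) ⧸ [x, g] ≅ gl(m−k|n−k) for a rank-k self-commuting odd element x of g = gl(m|n).) -/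
open Matrix

theorem Matrix.exists_mul_mul_eq_self {K α β : Type*} [Field K] [Fintype α] [Fintype β]
    [DecidableEq α] [DecidableEq β] (A : Matrix α β K) :
    ∃ G : Matrix β α K, A * G * A = A := by
  obtain ⟨g, hg⟩ := (toLin' A).rangeRestrict.exists_rightInverse_of_surjective
    (LinearMap.range_rangeRestrict _)
  obtain ⟨g', hg'⟩ := LinearMap.exists_extend g
  refine ⟨LinearMap.toMatrix' g', ?_⟩
  apply (toLin' (R := K)).injective
  rw [toLin'_mul, toLin'_mul, toLin'_toMatrix']
  refine LinearMap.ext fun v => ?_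
  have h1 : g' (toLin' A v) = g ((toLin' A).rangeRestrict v) :=
    LinearMap.congr_fun hg' ((toLin' A).rangeRestrict v)
  have h2 := congrArg Subtype.val (LinearMap.congr_fun hg ((toLin' A).rangeRestrict v))
  rw [LinearMap.comp_apply, LinearMap.comp_apply, h1]
  exact h2

theorem LinearMap.trace_eq_finrank_range_of_isIdempotentElem {K V : Type*} [Field K]
    [AddCommGroup V] [Module K V] [FiniteDimensional K V] {f : V →ₗ[K] V}
    (hf : IsIdempotentElem f) :
    LinearMap.trace K V f = Module.finrank K (LinearMap.range f) := by
  refine LinearMap.IsProj.trace ⟨fun v => ⟨v, rfl⟩, ?_⟩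
  rintro _ ⟨v, rfl⟩
  exact LinearMap.congr_fun hf v

theorem Matrix.trace_eq_rank_of_isIdempotentElem {K α : Type*} [Field K] [Fintype α]
    [DecidableEq α] {P : Matrix α α K} (hP : IsIdempotentElem P) : P.trace = P.rank := by
  rw [← trace_toLin'_eq, LinearMap.trace_eq_finrank_range_of_isIdempotentElem]
  · rfl
  · rw [IsIdempotentElem, Module.End.mul_eq_comp, ← toLin'_mul, hP.eq]

theorem Matrix.trace_mul_eq_rank {K α β : Type*} [Field K] [Fintype α] [Fintype β]
    [DecidableEq α] [DecidableEq β] {A : Matrix α β K} {G : Matrix β α K}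
    (h : A * G * A = A) : (A * G).trace = A.rank := by
  rw [trace_eq_rank_of_isIdempotentElem (by rw [IsIdempotentElem, ← Matrix.mul_assoc, h])]
  congr 1
  refine le_antisymm (rank_mul_le_left A G) ?_
  calc A.rank = (A * G * A).rank := by rw [h]
    _ ≤ (A * G).rank := rank_mul_le_left _ _

theorem Matrix.trace_mulLeftRight {K α : Type*} [Field K] [Fintype α] [DecidableEq α]
    (P Q : Matrix α α K) :
    LinearMap.trace K _ (LinearMap.mulLeftRight K (P, Q)) = P.trace * Q.trace := by
  rw [LinearMap.trace_eq_matrix_trace K (Matrix.stdBasis K α α), trace, Fintype.sum_prod_type,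
    trace, trace, Finset.sum_mul_sum]
  refine Finset.sum_congr rfl fun i _ => Finset.sum_congr rfl fun j _ => ?_
  rw [diag_apply, LinearMap.toMatrix_apply, stdBasis_eq_single, LinearMap.mulLeftRight_apply]
  have h : (Matrix.stdBasis K α α).repr (P * single i j 1 * Q) (i, j) =
      (P * single i j (1 : K) * Q : Matrix α α K) i j := by simp [stdBasis]
  rw [h, Matrix.mul_apply, Finset.sum_eq_single j]
  · simp
  · intro k _ hk
    rw [mul_single_apply_of_ne _ _ _ _ _ hk, zero_mul]
  · simp

theorem Matrix.finrank_range_mulLeftRight {α : Type*} [Fintype α] [DecidableEq α]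
    {P : Matrix α α ℂ} (hP : IsIdempotentElem P) :
    Module.finrank ℂ (LinearMap.range (LinearMap.mulLeftRight ℂ (P, P))) = P.rank ^ 2 := by
  have h : IsIdempotentElem (LinearMap.mulLeftRight ℂ (P, P)) := by
    refine LinearMap.ext fun z => ?_
    have : P * (P * z * P) * P = P * P * z * (P * P) := by noncomm_ring
    simp only [Module.End.mul_apply, LinearMap.mulLeftRight_apply]
    rw [this, hP.eq]
  have h1 := LinearMap.trace_eq_finrank_range_of_isIdempotentElem h
  rw [trace_mulLeftRight, trace_eq_rank_of_isIdempotentElem hP] at h1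
  rw [sq]
  exact_mod_cast h1.symm

/-- If `h` is an odd generalized inverse of a square-zero odd element `x` such that
`p = 1 - (x h + h x)` is idempotent, then the homology of the super-adjoint operator of `x`
has the dimension of the corner `p A p`. -/
theorem LinearMap.finrank_homology_of_contraction {K A : Type*} [Field K] [Ring A] [Algebra K A]
    {x J h p : A} (hJJ : J * J = 1) (hJx : J * x = -(x * J)) (hJh : J * h = -(h * J))
    (hxx : x * x = 0) (hxhx : x * h * x = x) (hp : p = 1 - (x * h + h * x))
    (hpp : p * p = p) (D : A →ₗ[K] A) (hD : ∀ z, D z = x * z - J * z * J * x) :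
    Module.finrank K (↥(LinearMap.ker D) ⧸ (LinearMap.range D).comap (LinearMap.ker D).subtype) =
      Module.finrank K (LinearMap.range (LinearMap.mulLeftRight K (p, p))) := by
  have hxp : x * p = 0 := by
    calc x * p = x - (x * x * h + x * h * x) := by rw [hp]; noncomm_ring
      _ = 0 := by rw [hxx, hxhx]; simp
  have hpx : p * x = 0 := by
    calc p * x = x - (x * h * x + h * (x * x)) := by rw [hp]; noncomm_ring
      _ = 0 := by rw [hxx, hxhx]; simp
  have hJp : J * p = p * J := by
    have h1 : J * (x * h) = x * h * J := by
      rw [← mul_assoc, hJx, neg_mul, mul_assoc x J, hJh]; noncomm_ring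
    have h2 : J * (h * x) = h * x * J := by
      rw [← mul_assoc, hJh, neg_mul, mul_assoc h J, hJx]; noncomm_ring
    rw [hp, mul_sub, mul_add, h1, h2]; noncomm_ring
  let Φ := (LinearMap.mulLeftRight K (p, p)).comp (LinearMap.ker D).subtype
  have hΦ (z : LinearMap.ker D) : Φ z = p * z * p := rfl
  have hker : LinearMap.ker Φ = (LinearMap.range D).comap (LinearMap.ker D).subtype := by
    ext ⟨z, hz⟩
    rw [LinearMap.mem_ker, Submodule.mem_comap, hΦ, Submodule.subtype_apply]
    constructor
    · intro h0
      have h0 : p * z * p = 0 := h0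
      have hz : x * z = J * z * J * x := by rwa [LinearMap.mem_ker, hD, sub_eq_zero] at hz
      have e1 : D (h * z) = (x * h + h * x) * z := by
        rw [hD, ← mul_assoc J, hJh]
        calc x * (h * z) - -(h * J) * z * J * x = x * h * z + h * (J * z * J * x) := by
              noncomm_ring
          _ = _ := by rw [← hz]; noncomm_ring
      have e2 : D (J * (p * z) * J * h) = p * z * (x * h + h * x) := by
        have a1 : x * J = -(J * x) := by rw [hJx, neg_neg]
        have a2 : x * (J * (p * z) * J * h) = 0 := by
          calc x * (J * (p * z) * J * h) = x * J * p * z * J * h := by noncomm_ring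
            _ = -(J * (x * p) * z * J * h) := by rw [a1]; noncomm_ring
            _ = 0 := by rw [hxp]; simp
        have a3 : p * z * x = 0 := by
          calc p * z * x = p * (J * J) * z * (J * J) * x := by rw [hJJ]; simp
            _ = J * p * (J * z * J * (J * x)) := by rw [hJp]; noncomm_ring
            _ = -(J * p * (J * z * J * x) * J) := by rw [hJx]; noncomm_ring
            _ = -(J * (p * x) * z * J) := by rw [← hz]; noncomm_ring
            _ = 0 := by rw [hpx]; simp
        rw [hD, a2]
        calc 0 - J * (J * (p * z) * J * h) * J * x
            = -(J * J * (p * z) * (J * h) * J * x) := by noncomm_ring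
          _ = p * z * h * (J * J) * x := by rw [hJJ, one_mul, hJh, ← hJJ]; noncomm_ring
          _ = p * z * x * h + p * z * h * x := by rw [hJJ, a3]; simp
          _ = _ := by noncomm_ring
      refine ⟨h * z + J * (p * z) * J * h, ?_⟩
      have e : x * h + h * x = 1 - p := by rw [hp]; noncomm_ring
      rw [map_add, e1, e2, e]
      calc (1 - p) * z + p * z * (1 - p) = z - p * z * p := by noncomm_ring
        _ = z := by rw [h0, sub_zero]
    · rintro ⟨y, hy⟩
      change p * z * p = 0
      rw [← show D y = z from hy, hD]
      calc p * (x * y - J * y * J * x) * p = p * x * y * p - p * J * y * J * (x * p) := by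
            noncomm_ring
        _ = 0 := by rw [hpx, hxp]; simp
  have hrange : LinearMap.range Φ = LinearMap.range (LinearMap.mulLeftRight K (p, p)) := by
    refine le_antisymm (LinearMap.range_comp_le_range _ _) ?_
    rintro _ ⟨z, rfl⟩
    refine ⟨⟨p * z * p, ?_⟩, ?_⟩
    · rw [LinearMap.mem_ker, hD]
      calc x * (p * z * p) - J * (p * z * p) * J * x
          = x * p * z * p - J * p * z * (p * J) * x := by noncomm_ring
        _ = x * p * z * p - J * p * z * J * (p * x) := by rw [← hJp]; noncomm_ring
        _ = 0 := by rw [hxp, hpx]; simp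
    · change p * (p * z * p) * p = p * z * p
      calc p * (p * z * p) * p = p * p * z * (p * p) := by noncomm_ring
        _ = _ := by rw [hpp]
  rw [← hker, ← hrange]
  exact Φ.quotKerEquivRange.finrank_eq


/-- For `g = gl(m|n)` and a self-commuting odd element `x = [[0,B],[C,0]]` of rank
`k = rank B + rank C`, the super-adjoint operator `D(z) = x·z − J·z·J·x` (with
`J = diag(Iₘ, −Iₙ)`) squares to zero, and the homology `ker D ⧸ range D` has
dimension `(m + n − 2k)²` (realizing `g_x ≅ gl(m−k|n−k)` at the level of dimensions). -/
theorem gl_DS_of_adjoint_dimension (m n : ℕ)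
    (B : Matrix (Fin m) (Fin n) ℂ) (C : Matrix (Fin n) (Fin m) ℂ)
    (hBC : B * C = 0) (hCB : C * B = 0)
    (x J : Matrix (Fin m ⊕ Fin n) (Fin m ⊕ Fin n) ℂ)
    (hx : x = Matrix.fromBlocks 0 B C 0)
    (hJ : J = Matrix.fromBlocks 1 0 0 (-1))
    (D : Matrix (Fin m ⊕ Fin n) (Fin m ⊕ Fin n) ℂ →ₗ[ℂ]
         Matrix (Fin m ⊕ Fin n) (Fin m ⊕ Fin n) ℂ)
    (hD : ∀ z, D z = x * z - J * z * J * x) :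
    (∀ z, D (D z) = 0) ∧
    Module.finrank ℂ
        (↥(LinearMap.ker D) ⧸ (LinearMap.range D).comap (LinearMap.ker D).subtype) =
      (m + n - 2 * (B.rank + C.rank)) ^ 2 := by
  have hJJ : J * J = 1 := by
    rw [hJ, fromBlocks_multiply, ← fromBlocks_one]; simp
  have hJx : J * x = -(x * J) := by
    rw [hJ, hx, fromBlocks_multiply, fromBlocks_multiply, fromBlocks_neg]; simp
  have hxx : x * x = 0 := by
    rw [hx, fromBlocks_multiply]; simp [hBC, hCB]
  refine ⟨fun z => ?_, ?_⟩
  · rw [hD, hD]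
    calc x * (x * z - J * z * J * x) - J * (x * z - J * z * J * x) * J * x
        = x * x * z - x * J * z * J * x - J * x * z * J * x
          + J * J * z * J * (x * J) * x := by noncomm_ring
      _ = x * x * z - J * J * z * J * J * (x * x) := by
          rw [show x * J = -(J * x) by rw [hJx, neg_neg]]; noncomm_ring
      _ = 0 := by rw [hxx]; simp
  obtain ⟨B', hB'⟩ := B.exists_mul_mul_eq_self
  obtain ⟨C', hC'⟩ := C.exists_mul_mul_eq_self
  obtain ⟨g, hg⟩ : ∃ g, g = fromBlocks 0 C' B' 0 := ⟨_, rfl⟩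
  have hJg : J * g = -(g * J) := by
    rw [hJ, hg, fromBlocks_multiply, fromBlocks_multiply, fromBlocks_neg]; simp
  have hxgx : x * g * x = x := by
    rw [hx, hg, fromBlocks_multiply, fromBlocks_multiply]; simp [hB', hC']
  have htr : (x * g).trace = (B.rank + C.rank : ℕ) := by
    rw [hx, hg, fromBlocks_multiply, trace, Fintype.sum_sum_type]
    simp [← trace_mul_eq_rank hB', ← trace_mul_eq_rank hC', trace]
  -- correct `g` so that `x * h * h * x = 0`
  obtain ⟨h, hh⟩ : ∃ h, h = g - x * g * g := ⟨_, rfl⟩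
  have hJh : J * h = -(h * J) := by
    have : J * (x * g * g) = -(x * g * g * J) := by
      calc J * (x * g * g) = J * x * g * g := by noncomm_ring
        _ = -(x * (J * g) * g) := by rw [hJx]; noncomm_ring
        _ = x * (g * J) * g := by rw [hJg]; noncomm_ring
        _ = x * g * (J * g) := by noncomm_ring
        _ = _ := by rw [hJg]; noncomm_ring
    rw [hh, mul_sub, this, hJg]; noncomm_ring
  have hxh : x * h = x * g := by
    calc x * h = x * g - x * x * g * g := by rw [hh]; noncomm_ring
      _ = x * g := by rw [hxx]; simp
  have hxhx : x * h * x = x := by rw [hxh, hxgx]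
  have hxhhx : x * h * h * x = 0 := by
    calc x * h * h * x = x * g * g * x - x * g * x * g * g * x := by
          rw [hxh, hh]; noncomm_ring
      _ = 0 := by rw [hxgx, sub_self]
  obtain ⟨p, hp⟩ : ∃ p, p = 1 - (x * h + h * x) := ⟨_, rfl⟩
  have he : IsIdempotentElem (x * h + h * x) := by
    calc (x * h + h * x) * (x * h + h * x)
        = x * h * x * h + x * h * h * x + h * (x * x) * h + h * (x * h * x) := by noncomm_ring
      _ = x * h + h * x := by rw [hxhx, hxhhx, hxx]; simp
  have hpp : IsIdempotentElem p := hp ▸ he.one_sub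
  have hrank : p.rank + 2 * (B.rank + C.rank) = m + n := by
    have h1 := trace_eq_rank_of_isIdempotentElem hpp
    have h3 : p.trace = (1 : Matrix (Fin m ⊕ Fin n) (Fin m ⊕ Fin n) ℂ).trace -
        ((x * g).trace + (x * g).trace) := by
      rw [hp, trace_sub, trace_add, trace_mul_comm h x, hxh]
    rw [h3, htr, trace_one] at h1
    have h2 : ((m + n : ℕ) : ℂ) = (p.rank + 2 * (B.rank + C.rank) : ℕ) := by
      rw [Fintype.card_sum, Fintype.card_fin, Fintype.card_fin] at h1
      rw [Nat.cast_add p.rank, ← h1]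
      push_cast; ring
    exact_mod_cast h2.symm
  rw [LinearMap.finrank_homology_of_contraction hJJ hJx hJh hxx hxhx hp hpp.eq D hD,
    finrank_range_mulLeftRight hpp, ← hrank, Nat.add_sub_cancel]
end

section
/- Let Z and Z' be commutative unital ℂ-algebras, η : Z → Z' a ℂ-algebra homomorphism, and σ : Z' → Z' a ℂ-algebra automorphism with σ ∘ σ = id whose fixed subalgebra {a ∈ Z' : σ(a) = a} equals the image of η. Let χ : Z → ℂ be a character and suppose there exists a character χ' : Z' → ℂ with χ' ∘ η = χ. Then for every character χ'' : Z' → ℂ with χ'' ∘ η = χ one has χ'' = χ' or χ'' = χ' ∘ σ; that is, the preimage (η*)⁻¹(χ) of χ under the pullback map on characters is exactly {χ', χ' ∘ σ}. -/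
/-- If the fixed subalgebra of an involution `σ` of `Z'` equals the image of
`η : Z → Z'`, then the fiber of the pullback map on characters over a character
`χ` of `Z` is exactly `{χ', χ' ∘ σ}` for any character `χ'` lying over `χ`. -/
theorem preimage_of_character_pullback {Z Z' : Type*}
    [CommRing Z] [CommRing Z'] [Algebra ℂ Z] [Algebra ℂ Z']
    (η : Z →ₐ[ℂ] Z') (σ : Z' →ₐ[ℂ] Z')
    (hσ : ∀ a, σ (σ a) = a)
    (hfix : {a : Z' | σ a = a} = Set.range η)
    (χ : Z →ₐ[ℂ] ℂ) (χ' : Z' →ₐ[ℂ] ℂ) (hχ' : χ'.comp η = χ)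
    (χ'' : Z' →ₐ[ℂ] ℂ) (hχ'' : χ''.comp η = χ) :
    χ'' = χ' ∨ χ'' = χ'.comp σ := by
  have key : ∀ c, σ c = c → χ'' c = χ' c := by
    intro c hc
    obtain ⟨z, rfl⟩ : c ∈ Set.range η := hfix ▸ hc
    exact DFunLike.congr_fun (hχ''.trans hχ'.symm) z
  have pointwise : ∀ a, χ'' a = χ' a ∨ χ'' a = χ' (σ a) := by
    intro a
    have hadd := key (a + σ a) (by rw [map_add, hσ, add_comm])
    have hmul := key (a * σ a) (by rw [map_mul, hσ, mul_comm])
    rw [map_add, map_add] at hadd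
    rw [map_mul, map_mul] at hmul
    have h : (χ'' a - χ' a) * (χ'' a - χ' (σ a)) = 0 := by
      linear_combination χ'' a * hadd - hmul
    simpa [sub_eq_zero] using h
  by_contra! hne
  obtain ⟨a, ha⟩ := DFunLike.ne_iff.mp hne.1
  obtain ⟨b, hb⟩ := DFunLike.ne_iff.mp hne.2
  rw [AlgHom.comp_apply] at hb
  have ha' := (pointwise a).resolve_left ha
  have hb' := (pointwise b).resolve_right hb
  rcases pointwise (a + b) with h | h
  · rw [map_add, map_add, hb'] at h
    exact ha (add_right_cancel h)
  · rw [map_add, map_add, map_add, ha'] at h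
    exact hb (add_left_cancel h)
end

section
/- Let Z and Z' be commutative unital ℂ-algebras, η : Z → Z' a ℂ-algebra homomorphism, and σ : Z' → Z' a ℂ-algebra automorphism with σ ∘ σ = id whose fixed subalgebra {a ∈ Z' : σ(a) = a} equals the image of η. Let χ : Z → ℂ and χ' : Z' → ℂ be characters with χ' ∘ η = χ, and let V be a Z'-module such that η(ker χ)·V = 0. Then: (1) if χ' ∘ σ ≠ χ', there is a direct sum decomposition V = V₊ ⊕ V₋ of Z'-submodules with (ker χ')·V₊ = 0 and (ker(χ' ∘ σ))·V₋ = 0; (2) if χ' ∘ σ = χ', then (ker χ')²·V = 0. -/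
/-- An involution of a commutative `ℂ`-algebra splits every element into a fixed part and an
anti-fixed part. -/
theorem exists_add_fixed_antifixed {A : Type*} [CommRing A] [Algebra ℂ A] (σ : A →ₐ[ℂ] A)
    (hσ : ∀ a, σ (σ a) = a) (z : A) :
    ∃ s d : A, σ s = s ∧ σ d = -d ∧ z = s + d := by
  refine ⟨(1 / 2 : ℂ) • (z + σ z), (1 / 2 : ℂ) • (z - σ z), ?_, ?_, ?_⟩
  · rw [map_smul, map_add, hσ, add_comm]
  · rw [map_smul, map_sub, hσ, ← smul_neg, neg_sub]
  · rw [← smul_add, add_add_sub_cancel, ← two_smul ℂ z, smul_smul]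
    norm_num

/-- If `χ ∘ σ ≠ χ`, there is an element anti-fixed by the involution `σ` on which `χ` is `1`. -/
theorem exists_antifixed_map_eq_one {A : Type*} [CommRing A] [Algebra ℂ A] (σ : A →ₐ[ℂ] A)
    (hσ : ∀ a, σ (σ a) = a) (χ : A →ₐ[ℂ] ℂ) (hne : χ.comp σ ≠ χ) :
    ∃ b : A, σ b = -b ∧ χ b = 1 := by
  obtain ⟨a, ha⟩ := DFunLike.ne_iff.mp hne
  have hc : χ a - χ (σ a) ≠ 0 := sub_ne_zero.mpr (Ne.symm ha)
  refine ⟨(χ a - χ (σ a))⁻¹ • (a - σ a), ?_, ?_⟩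
  · rw [map_smul, map_sub, hσ, ← smul_neg, neg_sub]
  · rw [map_smul, map_sub, smul_eq_mul, inv_mul_cancel₀ hc]

/-- If `b ^ 2` acts as the identity, the module is the direct sum of the `1`- and
`-1`-eigenspaces of `b`. -/
theorem isCompl_ker_lsmul_sub_one_add_one {A V : Type*} [CommRing A] [Algebra ℂ A]
    [AddCommGroup V] [Module A V] (b : A) (hb : ∀ v : V, (b * b) • v = v) :
    IsCompl (LinearMap.ker (LinearMap.lsmul A V (b - 1)))
      (LinearMap.ker (LinearMap.lsmul A V (b + 1))) := by
  set h : A := algebraMap ℂ A (1 / 2)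
  have hh : h * 2 = 1 := by
    rw [← map_ofNat (algebraMap ℂ A) 2, ← map_mul]
    norm_num
  have hb' (v : V) : (b * b - 1) • v = 0 := by rw [sub_smul, hb, one_smul, sub_self]
  constructor
  · rw [Submodule.disjoint_def]
    intro v hp hm
    simp only [LinearMap.mem_ker, LinearMap.lsmul_apply] at hp hm
    have : v = h • ((b + 1) • v - (b - 1) • v) := by
      rw [← sub_smul, smul_smul, show h * (b + 1 - (b - 1)) = 1 by linear_combination hh, one_smul]
    rw [this, hp, hm, sub_self, smul_zero]
  · rw [codisjoint_iff, Submodule.eq_top_iff']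
    intro v
    refine Submodule.mem_sup.mpr ⟨(h * (1 + b)) • v, ?_, (h * (1 - b)) • v, ?_, ?_⟩
    · rw [LinearMap.mem_ker, LinearMap.lsmul_apply, smul_smul,
        show (b - 1) * (h * (1 + b)) = h * (b * b - 1) by ring, mul_smul, hb', smul_zero]
    · rw [LinearMap.mem_ker, LinearMap.lsmul_apply, smul_smul,
        show (b + 1) * (h * (1 - b)) = (-h) * (b * b - 1) by ring, mul_smul, hb', smul_zero]
    · rw [← add_smul, show h * (1 + b) + h * (1 - b) = 1 by linear_combination hh, one_smul]

/-- Behavior of generalized central characters under the Duflo–Serganova functor: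
if `V` is a `Z'`-module annihilated by `η(ker χ)`, then either (when `χ' ∘ σ ≠ χ'`)
`V` splits as a direct sum of submodules annihilated by `ker χ'` and `ker (χ' ∘ σ)`
respectively, or (when `χ' ∘ σ = χ'`) `V` is annihilated by `(ker χ')²`. -/
theorem central_character_dichotomy {Z Z' : Type*}
    [CommRing Z] [CommRing Z'] [Algebra ℂ Z] [Algebra ℂ Z']
    (η : Z →ₐ[ℂ] Z') (σ : Z' →ₐ[ℂ] Z')
    (hσ : ∀ a, σ (σ a) = a)
    (hfix : {a : Z' | σ a = a} = Set.range η)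
    (χ : Z →ₐ[ℂ] ℂ) (χ' : Z' →ₐ[ℂ] ℂ) (hχ' : χ'.comp η = χ)
    (V : Type*) [AddCommGroup V] [Module Z' V]
    (hV : ∀ z : Z, χ z = 0 → ∀ v : V, η z • v = 0) :
    (χ'.comp σ ≠ χ' →
      ∃ (Vp Vm : Submodule Z' V), IsCompl Vp Vm ∧
        (∀ z : Z', χ' z = 0 → ∀ v ∈ Vp, z • v = 0) ∧
        (∀ z : Z', χ' (σ z) = 0 → ∀ v ∈ Vm, z • v = 0)) ∧
    (χ'.comp σ = χ' →
      ∀ z w : Z', χ' z = 0 → χ' w = 0 → ∀ v : V, z • w • v = 0) := by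
  have hfixed (f : Z') (hf : σ f = f) (h0 : χ' f = 0) (v : V) : f • v = 0 := by
    obtain ⟨z, rfl⟩ : f ∈ Set.range η := hfix ▸ hf
    exact hV z (by rw [← hχ']; exact h0) v
  constructor
  · intro hne
    obtain ⟨b, hσb, hb⟩ := exists_antifixed_map_eq_one σ hσ χ' hne
    have hbb (v : V) : (b * b) • v = v := by
      have := hfixed (b * b - 1) (by simp [hσb]) (by simp [hb]) v
      rwa [sub_smul, one_smul, sub_eq_zero] at this
    refine ⟨_, _, isCompl_ker_lsmul_sub_one_add_one b hbb, ?_, ?_⟩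
    · intro z hz v hv
      rw [LinearMap.mem_ker, LinearMap.lsmul_apply] at hv
      obtain ⟨s, d, hs, hd, rfl⟩ := exists_add_fixed_antifixed σ hσ z
      have := hfixed (s + d * b) (by simp [hs, hd, hσb]) (by simpa [hb] using hz) v
      rw [show s + d = (s + d * b) - d * (b - 1) by ring, sub_smul, this, mul_smul, hv,
        smul_zero, sub_zero]
    · intro z hz v hv
      rw [LinearMap.mem_ker, LinearMap.lsmul_apply] at hv
      obtain ⟨s, d, hs, hd, rfl⟩ := exists_add_fixed_antifixed σ hσ z
      have := hfixed (s - d * b) (by simp [hs, hd, hσb])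
        (by simpa [hb, hs, hd, sub_eq_add_neg] using hz) v
      rw [show s + d = (s - d * b) + d * (b + 1) by ring, add_smul, this, mul_smul, hv,
        smul_zero, add_zero]
  · intro heq z w hz hw v
    have hanti (d : Z') (hd : σ d = -d) : χ' d = 0 := by
      have h : χ' (σ d) = χ' d := DFunLike.congr_fun heq d
      rw [hd, map_neg] at h
      exact self_eq_neg.mp h.symm
    obtain ⟨s, d, hs, hd, rfl⟩ := exists_add_fixed_antifixed σ hσ z
    obtain ⟨t, e, ht, he, rfl⟩ := exists_add_fixed_antifixed σ hσ w
    rw [map_add, hanti d hd, add_zero] at hz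
    rw [map_add, hanti e he, add_zero] at hw
    have hde := hfixed (d * e) (by simp [hd, he]) (by simp [hanti d hd]) v
    rw [add_smul t, hfixed t ht hw, zero_add, add_smul, hfixed s hs hz, zero_add, smul_smul, hde]
end

section
/- Let A be a commutative unital ℂ-algebra with a ℂ-algebra involution σ (σ ∘ σ = id) whose fixed subalgebra {a ∈ A : σ(a) = a} is exactly ℂ·1, and let A₋ := {a ∈ A : σ(a) = −a} (so A = ℂ·1 ⊕ A₋). Then exactly one of the following holds: either there exists a ∈ A₋ with a² = 1 and A₋ = ℂ·a, or a₁·a₂ = 0 for all a₁, a₂ ∈ A₋ (i.e. A₋ squares to zero, and then A₋ is the unique maximal ideal of A). -/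
/-- Dichotomy for a commutative `ℂ`-algebra `A` with an involution `σ` whose fixed
subalgebra is exactly `ℂ·1`: letting `A₋ = {a | σ a = −a}`, either there is `a ∈ A₋`
with `a² = 1` and `A₋ = ℂ·a`, or all products of elements of `A₋` vanish — and
exactly one of these alternatives holds. -/
theorem antiinvariants_dichotomy {A : Type*} [CommRing A] [Algebra ℂ A] [Nontrivial A]
    (σ : A →ₐ[ℂ] A) (hσ : ∀ a, σ (σ a) = a)
    (hfix : {a : A | σ a = a} = Set.range (algebraMap ℂ A)) :
    Xor' (∃ a : A, σ a = -a ∧ a * a = 1 ∧ ∀ b : A, σ b = -b → ∃ c : ℂ, b = c • a)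
         (∀ a₁ a₂ : A, σ a₁ = -a₁ → σ a₂ = -a₂ → a₁ * a₂ = 0) := by
  have mul_scalar : ∀ x y : A, σ x = -x → σ y = -y → ∃ c : ℂ, x * y = algebraMap ℂ A c := by
    intro x y hx hy
    have hxy : x * y ∈ {a : A | σ a = a} := by simp [hx, hy]
    rw [hfix] at hxy
    obtain ⟨c, hc⟩ := hxy
    exact ⟨c, hc.symm⟩
  by_cases h : ∀ a₁ a₂ : A, σ a₁ = -a₁ → σ a₂ = -a₂ → a₁ * a₂ = 0
  · refine Or.inr ⟨h, ?_⟩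
    rintro ⟨a, ha, ha1, -⟩
    exact one_ne_zero (ha1.symm.trans (h a a ha ha))
  · refine Or.inl ⟨?_, h⟩
    push Not at h
    obtain ⟨x, y, hx, hy, hxy⟩ := h
    obtain ⟨c, hc⟩ := mul_scalar x y hx hy
    obtain ⟨d, hd⟩ := mul_scalar x x hx hx
    have hc0 : c ≠ 0 := by
      rintro rfl
      exact hxy (by simpa using hc)
    have hd0 : d ≠ 0 := by
      rintro rfl
      have hzero : algebraMap ℂ A (c * c) = 0 := by
        rw [map_mul, ← hc, mul_mul_mul_comm, hd, map_zero, zero_mul]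
      exact mul_ne_zero hc0 hc0
        ((map_eq_zero_iff _ (algebraMap ℂ A).injective).mp hzero)
    obtain ⟨s, hs⟩ := IsAlgClosed.exists_eq_mul_self d
    have hs0 : s ≠ 0 := by
      rintro rfl
      exact hd0 (by simpa using hs)
    have ha : σ (s⁻¹ • x) = -(s⁻¹ • x) := by rw [map_smul, hx, smul_neg]
    have ha1 : (s⁻¹ • x) * (s⁻¹ • x) = 1 := by
      rw [smul_mul_smul_comm, hd, Algebra.smul_def, ← map_mul, hs]
      have : s⁻¹ * s⁻¹ * (s * s) = 1 := by field_simp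
      rw [this, map_one]
    refine ⟨s⁻¹ • x, ha, ha1, fun b hb => ?_⟩
    obtain ⟨e, he⟩ := mul_scalar b _ hb ha
    refine ⟨e, ?_⟩
    rw [Algebra.smul_def e, ← he, mul_assoc, ha1, mul_one]
end

section
/- Let R be a ring and let (N, d_N), (M, d_M), (L, d_L) be R-modules each equipped with an R-linear endomorphism squaring to zero. Suppose ψ : N → M and φ : M → L are R-linear maps with ψ injective, φ surjective, ker φ = range ψ, d_M ∘ ψ = ψ ∘ d_N and d_L ∘ φ = φ ∘ d_M. Write H(P) := ker d_P ⧸ range d_P and let H(ψ) : H(N) → H(M) and H(φ) : H(M) → H(L) be the induced maps. Then: (1) the sequence is exact at H(M), i.e. ker H(φ) = range H(ψ); and (2) there is an isomorphism of R-modules ker H(ψ) ≅ H(L) ⧸ range H(φ). (Equivalently, there is an exact sequence 0 → E → H(N) → H(M) → H(L) → E → 0 with E := ker H(ψ); this is Hinich's lemma showing that the Duflo–Serganova functor DS_x is middle exact with kernel and cokernel related by the parity shift Π.) -/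
/-- The homology `ker d ⧸ range d` of a square-zero endomorphism `d` of a module. -/
abbrev SqZeroHomology {R M : Type*} [Ring R] [AddCommGroup M] [Module R M]
    (d : M →ₗ[R] M) : Type _ :=
  ↥(LinearMap.ker d) ⧸ (LinearMap.range d).comap (LinearMap.ker d).subtype

/-- A cycle represents zero in homology exactly when it is a boundary. -/
theorem SqZeroHomology.mk_eq_zero_iff {R M : Type*} [Ring R] [AddCommGroup M] [Module R M]
    {d : M →ₗ[R] M} (x : LinearMap.ker d) :
    (Submodule.Quotient.mk x : SqZeroHomology d) = 0 ↔ ∃ y, d y = x := by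
  simp [Submodule.Quotient.mk_eq_zero]

/-- Two cycles represent the same homology class exactly when they differ by a boundary. -/
theorem SqZeroHomology.mk_eq_mk_iff {R M : Type*} [Ring R] [AddCommGroup M] [Module R M]
    {d : M →ₗ[R] M} (x y : LinearMap.ker d) :
    (Submodule.Quotient.mk x : SqZeroHomology d) = Submodule.Quotient.mk y ↔
      ∃ z, d z = x - y := by
  simp [Submodule.Quotient.eq]

/-- Two surjective linear maps out of the same module with equal kernels have isomorphic
targets. -/
theorem LinearMap.nonempty_linearEquiv_of_ker_eq {R P A B : Type*} [Ring R]
    [AddCommGroup P] [AddCommGroup A] [AddCommGroup B] [Module R P] [Module R A] [Module R B]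
    (f : P →ₗ[R] A) (g : P →ₗ[R] B) (hf : Function.Surjective f) (hg : Function.Surjective g)
    (h : LinearMap.ker f = LinearMap.ker g) : Nonempty (A ≃ₗ[R] B) :=
  ⟨(f.quotKerEquivOfSurjective hf).symm ≪≫ₗ Submodule.quotEquivOfEq _ _ h ≪≫ₗ
    g.quotKerEquivOfSurjective hg⟩

/-- Hinich's lemma: for a short exact sequence `0 → N → M → L → 0` of modules with
square-zero endomorphisms commuting with the maps, the induced sequence on homology
`H(N) → H(M) → H(L)` is exact at `H(M)`, and `ker H(ψ) ≅ H(L) ⧸ range H(φ)`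
(equivalently, there is an exact sequence `0 → E → H(N) → H(M) → H(L) → E → 0`). -/
theorem hinich_middle_exactness {R N M L : Type*} [Ring R]
    [AddCommGroup N] [AddCommGroup M] [AddCommGroup L]
    [Module R N] [Module R M] [Module R L]
    (dN : N →ₗ[R] N) (dM : M →ₗ[R] M) (dL : L →ₗ[R] L)
    (hdN : ∀ x, dN (dN x) = 0) (hdM : ∀ x, dM (dM x) = 0) (hdL : ∀ x, dL (dL x) = 0)
    (ψ : N →ₗ[R] M) (φ : M →ₗ[R] L)
    (hψinj : Function.Injective ψ) (hφsurj : Function.Surjective φ)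
    (hexact : LinearMap.ker φ = LinearMap.range ψ)
    (hψd : ∀ x, dM (ψ x) = ψ (dN x)) (hφd : ∀ x, dL (φ x) = φ (dM x))
    (Hψ : SqZeroHomology dN →ₗ[R] SqZeroHomology dM)
    (Hφ : SqZeroHomology dM →ₗ[R] SqZeroHomology dL)
    (hHψ : ∀ (x : LinearMap.ker dN) (y : LinearMap.ker dM), (y : M) = ψ x →
        Hψ (Submodule.Quotient.mk x) = Submodule.Quotient.mk y)
    (hHφ : ∀ (x : LinearMap.ker dM) (y : LinearMap.ker dL), (y : L) = φ x →
        Hφ (Submodule.Quotient.mk x) = Submodule.Quotient.mk y) :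
    LinearMap.ker Hφ = LinearMap.range Hψ ∧
    Nonempty (↥(LinearMap.ker Hψ) ≃ₗ[R] (SqZeroHomology dL ⧸ LinearMap.range Hφ)) := by
  have lift_of_map_eq_zero : ∀ m, φ m = 0 → ∃ n, ψ n = m := fun m hm ↦ by
    have : m ∈ LinearMap.ker φ := hm
    rwa [hexact] at this
  have comp_eq_zero : ∀ n, φ (ψ n) = 0 := fun n ↦ by
    have : ψ n ∈ LinearMap.range ψ := ⟨n, rfl⟩
    rwa [← hexact] at this
  have cycle_map_ψ : ∀ n : LinearMap.ker dN, dM (ψ n) = 0 := fun n ↦ by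
    rw [hψd, LinearMap.mem_ker.1 n.2, map_zero]
  have cycle_map_φ : ∀ m : LinearMap.ker dM, dL (φ m) = 0 := fun m ↦ by
    rw [hφd, LinearMap.mem_ker.1 m.2, map_zero]
  have Hψ_mk : ∀ n : LinearMap.ker dN,
      Hψ (Submodule.Quotient.mk n) = Submodule.Quotient.mk ⟨ψ n, cycle_map_ψ n⟩ :=
    fun n ↦ hHψ n _ rfl
  have Hφ_mk : ∀ m : LinearMap.ker dM,
      Hφ (Submodule.Quotient.mk m) = Submodule.Quotient.mk ⟨φ m, cycle_map_φ m⟩ :=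
    fun m ↦ hHφ m _ rfl
  constructor
  · ext q
    obtain ⟨m, rfl⟩ := Submodule.Quotient.mk_surjective _ q
    rw [LinearMap.mem_ker, Hφ_mk, SqZeroHomology.mk_eq_zero_iff]
    constructor
    · rintro ⟨l, hl⟩
      obtain ⟨m', rfl⟩ := hφsurj l
      obtain ⟨n, hn⟩ := lift_of_map_eq_zero (m - dM m') (by simp [← hφd, hl])
      have hdn : dN n = 0 := hψinj (by
        rw [← hψd, hn, map_sub, hdM, LinearMap.mem_ker.1 m.2, sub_zero, map_zero])
      refine ⟨Submodule.Quotient.mk ⟨n, hdn⟩, ?_⟩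
      rw [Hψ_mk, SqZeroHomology.mk_eq_mk_iff]
      exact ⟨-m', by simp [hn]⟩
    · rintro ⟨p, hp⟩
      obtain ⟨n, rfl⟩ := Submodule.Quotient.mk_surjective _ p
      rw [Hψ_mk, SqZeroHomology.mk_eq_mk_iff] at hp
      obtain ⟨m', hm'⟩ := hp
      exact ⟨φ (-m'), by rw [hφd, map_neg, hm']; simp [comp_eq_zero]⟩
  · -- Both sides are quotients of the module `Z` of lifts to `M` of cycles in `L`.
    let Z : Submodule R M := LinearMap.ker (dL ∘ₗ φ)
    have mem_Z : ∀ m, m ∈ Z ↔ dL (φ m) = 0 := fun m ↦ Iff.rfl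
    obtain ⟨s, hs⟩ : ∃ s : Z →ₗ[R] N, ∀ z, ψ (s z) = dM z := by
      refine ⟨(LinearEquiv.ofInjective ψ hψinj).symm.toLinearMap ∘ₗ
        (dM ∘ₗ Z.subtype).codRestrict (LinearMap.range ψ) fun z ↦ ?_, fun z ↦ ?_⟩
      · exact lift_of_map_eq_zero _ ((hφd z).symm.trans z.2)
      · exact congrArg Subtype.val ((LinearEquiv.ofInjective ψ hψinj).apply_symm_apply _)
    have cycle_s : ∀ z, dN (s z) = 0 := fun z ↦ hψinj (by rw [← hψd, hs, hdM, map_zero])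
    let connecting : Z →ₗ[R] LinearMap.ker Hψ :=
      (Submodule.mkQ _ ∘ₗ s.codRestrict (LinearMap.ker dN) cycle_s).codRestrict _ fun z ↦ by
        refine (Hψ_mk ⟨s z, cycle_s z⟩).trans ?_
        rw [SqZeroHomology.mk_eq_zero_iff]
        exact ⟨z, (hs z).symm⟩
    let proj : Z →ₗ[R] SqZeroHomology dL ⧸ LinearMap.range Hφ :=
      Submodule.mkQ _ ∘ₗ Submodule.mkQ _ ∘ₗ
        (φ ∘ₗ Z.subtype).codRestrict (LinearMap.ker dL) fun z ↦ z.2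
    have connecting_eq_zero : ∀ z, connecting z = 0 ↔ ∃ n, dN n = s z := fun z ↦
      Subtype.ext_iff.trans (SqZeroHomology.mk_eq_zero_iff ⟨s z, cycle_s z⟩)
    have proj_eq_zero : ∀ z, proj z = 0 ↔
        (Submodule.Quotient.mk ⟨φ z, z.2⟩ : SqZeroHomology dL) ∈ LinearMap.range Hφ := fun z ↦
      Submodule.Quotient.mk_eq_zero _
    refine LinearMap.nonempty_linearEquiv_of_ker_eq connecting proj ?_ ?_ ?_
    · rintro ⟨q, hq⟩
      obtain ⟨n, rfl⟩ := Submodule.Quotient.mk_surjective _ q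
      rw [LinearMap.mem_ker, Hψ_mk, SqZeroHomology.mk_eq_zero_iff] at hq
      obtain ⟨m, hm⟩ := hq
      have hmZ : m ∈ Z := by rw [mem_Z, hφd, hm, comp_eq_zero]
      have hsn : s ⟨m, hmZ⟩ = n := hψinj ((hs _).trans hm)
      exact ⟨⟨m, hmZ⟩, Subtype.ext (congrArg Submodule.Quotient.mk (Subtype.ext hsn))⟩
    · intro q
      obtain ⟨p, rfl⟩ := Submodule.Quotient.mk_surjective _ q
      obtain ⟨⟨l, hl⟩, rfl⟩ := Submodule.Quotient.mk_surjective _ p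
      obtain ⟨m, rfl⟩ := hφsurj l
      exact ⟨⟨m, hl⟩, rfl⟩
    · ext z
      rw [LinearMap.mem_ker, LinearMap.mem_ker, connecting_eq_zero, proj_eq_zero]
      constructor
      · rintro ⟨n, hn⟩
        have hcycle : dM (z - ψ n) = 0 := by rw [map_sub, hψd, hn, hs, sub_self]
        refine ⟨Submodule.Quotient.mk ⟨z - ψ n, hcycle⟩, ?_⟩
        rw [Hφ_mk, SqZeroHomology.mk_eq_mk_iff]
        exact ⟨0, by simp [comp_eq_zero]⟩
      · rintro ⟨p, hp⟩
        obtain ⟨m, rfl⟩ := Submodule.Quotient.mk_surjective _ p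
        rw [Hφ_mk, SqZeroHomology.mk_eq_mk_iff] at hp
        obtain ⟨l, hl⟩ := hp
        obtain ⟨m', rfl⟩ := hφsurj l
        obtain ⟨n, hn⟩ := lift_of_map_eq_zero (z - m + dM m') (by
          rw [map_add, map_sub, ← hφd, hl]; abel)
        refine ⟨n, hψinj ?_⟩
        rw [← hψd, hn, hs, map_add, map_sub, hdM, LinearMap.mem_ker.1 m.2, sub_zero, add_zero]
end
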